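/- arXiv:1606.01967 — 5 statements merged into one kernel-verified Lean document; each statement's English description precedes it below -/
import Mathlib

section
/- Let X be a uniform space such that the set C_ω(X) of ω-continuous real-valued functions on X is ω^ω-dominated in ℝ^X. Then for every metric space M and every ω-continuous map f : X → M, the image f(X) is a σ-compact subspace of M. -/
/-- A map `f : X → M` from a uniform space to a pseudometric space is ω-continuous
if for every `ε > 0` there is a countable family `𝒱` of entourages of `X` such that
every `x ∈ X` admits `V ∈ 𝒱` with `dist (f y) (f x) < ε` for all `y ∈ V[x]`. -/
def OmegaContinuous {X : Type*} [UniformSpace X] {M : Type*} [PseudoMetricSpace M]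
    (f : X → M) : Prop :=
  ∀ ε : ℝ, 0 < ε → ∃ 𝒱 : Set (Set (X × X)), 𝒱.Countable ∧ (∀ V ∈ 𝒱, V ∈ uniformity X) ∧
    ∀ x : X, ∃ V ∈ 𝒱, ∀ y : X, (x, y) ∈ V → dist (f y) (f x) < ε

open Set Filter Topology in
/-- A monotone function on `ω^ω` is bounded on some basic neighbourhood of each point. -/
lemma aux_local_bound (p : (ℕ → ℕ) → ℝ) (hp : Monotone p) (α : ℕ → ℕ) :
    ∃ n : ℕ, ∃ B : ℝ, ∀ β : ℕ → ℕ, (∀ i < n, β i = α i) → p β ≤ B := by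
  by_contra! h
  choose β hβ hlt using fun n : ℕ => h n (n : ℝ)
  let γ : ℕ → ℕ := fun i => α i + ∑ n ∈ Finset.range (i + 1), β n i
  have hle : ∀ n, β n ≤ γ := by
    intro n i
    by_cases hi : i < n
    · rw [hβ n i hi]; exact Nat.le_add_right _ _
    · have := Finset.single_le_sum (f := fun n => β n i) (s := Finset.range (i + 1))
        (fun _ _ => Nat.zero_le _) (Finset.mem_range.2 (by omega : n < i + 1))
      exact this.trans (Nat.le_add_left _ _)
  obtain ⟨n, hn⟩ := exists_nat_gt (p γ)
  have := hp (hle n)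
  have := hlt n
  linarith

open Set Filter Topology in
lemma aux_sep {Y : Type*} [MetricSpace Y] (ε : ℝ) :
    ∃ D : Set Y, D.Pairwise (fun x y => ε < dist x y) ∧ ∀ x, ∃ y ∈ D, dist x y ≤ max ε 0 := by
  obtain ⟨D, hD⟩ := zorn_subset {D : Set Y | D.Pairwise (fun x y => ε < dist x y)} (by
    intro c hc hch
    refine ⟨⋃₀ c, ?_, fun s hs => subset_sUnion_of_mem hs⟩
    exact (pairwise_sUnion hch.directedOn).2 fun s hs => hc hs)
  refine ⟨D, hD.prop, fun x => ?_⟩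
  by_contra! h
  have hx : x ∉ D := fun hx => by simpa using h x hx
  have : insert x D ∈ {D : Set Y | D.Pairwise (fun x y => ε < dist x y)} := by
    refine hD.prop.insert ?_
    intro y hy _
    have := (le_max_left ε 0).trans_lt (h y hy)
    exact ⟨this, by rwa [dist_comm]⟩
  exact hx (hD.le_of_ge this (subset_insert _ _) (mem_insert _ _))

open Set Filter Topology in
lemma aux_separable {Y : Type*} [MetricSpace Y] (φ : (ℕ → ℕ) → Y → ℝ) (hφ : Monotone φ)
    (hdom : ∀ g : C(Y, ℝ), ∃ α, ∀ y, g y ≤ φ α y) : SecondCountableTopology Y := by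
  refine Metric.secondCountable_of_almost_dense_set fun ε hε => ?_
  obtain ⟨D, hD, hcov⟩ := aux_sep (Y := Y) ε
  rw [max_eq_left hε.le] at hcov
  refine ⟨D, ?_, hcov⟩
  by_contra hunc
  let S := Σ n : ℕ, (Fin n → ℕ)
  obtain ⟨enc, henc⟩ := exists_injective_nat S
  let P : S → Y → ℝ → Prop := fun s x B => ∀ β : ℕ → ℕ, (∀ i : Fin s.1, β i = s.2 i) → φ β x ≤ B
  let E : S → Set Y := fun s => {x ∈ D | ∃ B, P s x B}
  have hψ : ∀ s x, ∃ B, x ∈ E s → P s x B := by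
    intro s x
    by_cases hx : x ∈ E s
    · obtain ⟨B, hB⟩ := hx.2; exact ⟨B, fun _ => hB⟩
    · exact ⟨0, fun h => absurd h hx⟩
  choose ψ hψ using hψ
  have hT : ∀ s, ∃ T : Set Y, T ⊆ E s ∧ T.Countable ∧ ((E s).Infinite → T.Infinite) := by
    intro s
    by_cases h : (E s).Infinite
    · refine ⟨range fun n => (h.natEmbedding _ n : Y), ?_, countable_range _, fun _ => ?_⟩
      · rintro _ ⟨n, rfl⟩; exact (h.natEmbedding _ n).2
      · exact infinite_range_of_injective
          (Subtype.val_injective.comp (h.natEmbedding _).injective)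
    · exact ⟨∅, empty_subset _, countable_empty, fun h' => absurd h' h⟩
  choose T hTE hTc hTi using hT
  obtain ⟨ι, hι⟩ := Set.countable_iff_exists_injOn.1 (countable_iUnion hTc)
  have hb : ∀ x : Y, ∃ b : ℝ, ∀ s, enc s ≤ ι x → ψ s x + 1 ≤ b := by
    intro x
    have hfin : {s | enc s ≤ ι x}.Finite := (finite_Iic (ι x)).preimage henc.injOn
    obtain ⟨b, hb⟩ := (hfin.image fun s => ψ s x + 1).bddAbove
    exact ⟨b, fun s hs => hb ⟨s, hs, rfl⟩⟩
  choose b hb using hb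
  obtain ⟨g, hg⟩ := exists_continuous_forall_mem_convex_of_local_const (X := Y) (E := ℝ)
    (t := fun x => {r | x ∈ D → b x ≤ r}) (by
      intro x
      by_cases hx : x ∈ D
      · simp only [hx, true_imp_iff]; exact convex_Ici (𝕜 := ℝ) (b x)
      · simpa [hx] using convex_univ) (by
      intro x
      have hev : ∀ᶠ y in 𝓝 x, dist y x < ε / 2 := Metric.ball_mem_nhds x (half_pos hε)
      by_cases h : ∃ d ∈ D, dist d x < ε / 2
      · obtain ⟨d, hd, hdx⟩ := h
        refine ⟨b d, hev.mono fun y hy hyD => ?_⟩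
        by_cases hyd : y = d
        · rw [hyd]
        · have h1 := hD hyD hd hyd
          have h2 := dist_triangle_right y d x
          simp only at h1
          linarith
      · push Not at h
        exact ⟨0, hev.mono fun y hy hyD => absurd hy (not_lt.2 (h y hyD))⟩)
  obtain ⟨α, hα⟩ := hdom g
  have hcovD : D ⊆ ⋃ n : ℕ, E ⟨n, fun i => α i⟩ := by
    intro x hx
    obtain ⟨n, B, hB⟩ := aux_local_bound (fun β => φ β x) (fun _ _ h => hφ h x) α
    exact mem_iUnion.2 ⟨n, hx, B, fun β hβ => hB β fun i hi => hβ ⟨i, hi⟩⟩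
  have hex : ∃ n : ℕ, (E ⟨n, fun i => α i⟩).Infinite := by
    by_contra! h
    exact hunc ((countable_iUnion fun n => (h n).countable).mono hcovD)
  obtain ⟨n, hn⟩ := hex
  set s : S := ⟨n, fun i => α i⟩ with hs
  have hinf := (hTi s hn).image (hι.mono (subset_iUnion T s))
  obtain ⟨_, ⟨x, hxT, rfl⟩, hx⟩ := hinf.exists_gt (enc s)
  have h1 := hb x s hx.le
  have h2 := hψ s x (hTE s hxT) α (fun i => rfl)
  have h3 := hg x (hTE s hxT).1
  have h4 := hα x
  linarith

open Set Filter Topology in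
lemma aux_compact_union {K : Type*} [MetricSpace K] (z : K) (C : ℕ → Set K)
    (hC : ∀ k, IsCompact (C k)) (hsub : ∀ k : ℕ, C k ⊆ Metric.ball z (1 / ((k : ℝ) + 1))) :
    IsCompact (insert z (⋃ k, C k)) := by
  intro f hf hle
  by_cases hz : ClusterPt z f
  · exact ⟨z, mem_insert _ _, hz⟩
  · have hz' : ∃ ε > 0, (Metric.ball z ε)ᶜ ∈ f := by
      rw [clusterPt_iff_not_disjoint, not_not, Filter.disjoint_iff] at hz
      obtain ⟨U, hU, V, hV, hUV⟩ := hz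
      obtain ⟨ε, hε, hb⟩ := Metric.mem_nhds_iff.1 hU
      exact ⟨ε, hε, mem_of_superset hV fun x hx hx' => disjoint_left.1 hUV (hb hx') hx⟩
    obtain ⟨ε, hε, hV⟩ := hz'
    obtain ⟨m, hm⟩ := exists_nat_one_div_lt hε
    have hcomp : IsCompact (⋃ k ∈ Finset.range m, C k) :=
      (Finset.range m).isCompact_biUnion fun k _ => hC k
    have hle' : f ≤ 𝓟 (⋃ k ∈ Finset.range m, C k) := by
      rw [le_principal_iff] at hle ⊢
      filter_upwards [hle, hV] with x hx hxV
      rcases hx with rfl | hx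
      · exact absurd (Metric.mem_ball_self hε) hxV
      · obtain ⟨k, hk⟩ := mem_iUnion.1 hx
        by_cases hkm : k < m
        · exact mem_biUnion (Finset.mem_coe.2 (Finset.mem_range.2 hkm)) hk
        · exfalso
          apply hxV
          have h1 := hsub k hk
          have h2 : 1 / ((k : ℝ) + 1) ≤ 1 / ((m : ℝ) + 1) := by
            have : (m : ℝ) ≤ k := by exact_mod_cast not_lt.1 hkm
            gcongr
          exact Metric.ball_subset_ball (h2.trans hm.le) h1
    obtain ⟨x, hx, hxf⟩ := hcomp hle'
    refine ⟨x, ?_, hxf⟩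
    obtain ⟨k, _, hk⟩ := mem_iUnion₂.1 hx
    exact mem_insert_of_mem _ (mem_iUnion.2 ⟨k, hk⟩)

/-- Points having a neighbourhood all of whose compact subsets inside `Z` are covered by some
`κ β` with `β ≤ α` below `n`. -/
def auxU {K : Type*} [TopologicalSpace K] (Z : Set K) (κ : (ℕ → ℕ) → Set K)
    (α : ℕ → ℕ) (n : ℕ) : Set K :=
  {x | ∃ N : Set K, IsOpen N ∧ x ∈ N ∧ ∀ C : Set K, IsCompact C → C ⊆ N → C ⊆ Z →
    ∃ β : ℕ → ℕ, (∀ i < n, β i ≤ α i) ∧ C ⊆ κ β}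

lemma auxU_open {K : Type*} [TopologicalSpace K] (Z : Set K) (κ : (ℕ → ℕ) → Set K)
    (α : ℕ → ℕ) (n : ℕ) : IsOpen (auxU Z κ α n) := by
  rw [isOpen_iff_forall_mem_open]
  rintro x ⟨N, hN, hx, h⟩
  exact ⟨N, fun y hy => ⟨N, hN, hy, h⟩, hN, hx⟩

lemma auxU_mono {K : Type*} [TopologicalSpace K] (Z : Set K) (κ : (ℕ → ℕ) → Set K)
    {α α' : ℕ → ℕ} {n : ℕ} (h : ∀ i < n, α i ≤ α' i) : auxU Z κ α n ⊆ auxU Z κ α' n := by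
  rintro x ⟨N, hN, hx, hC⟩
  refine ⟨N, hN, hx, fun C h1 h2 h3 => ?_⟩
  obtain ⟨β, hβ, hCβ⟩ := hC C h1 h2 h3
  exact ⟨β, fun i hi => (hβ i hi).trans (h i hi), hCβ⟩

lemma auxU_congr {K : Type*} [TopologicalSpace K] (Z : Set K) (κ : (ℕ → ℕ) → Set K)
    {α α' : ℕ → ℕ} {n : ℕ} (h : ∀ i < n, α i = α' i) : auxU Z κ α n = auxU Z κ α' n :=
  (auxU_mono Z κ fun i hi => (h i hi).le).antisymm (auxU_mono Z κ fun i hi => (h i hi).ge)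

open Set Filter Topology in
lemma auxU_step {K : Type*} [MetricSpace K] (Z : Set K) (κ : (ℕ → ℕ) → Set K)
    (α : ℕ → ℕ) (n : ℕ) {z : K} (hz : z ∈ Z) (hzU : z ∈ auxU Z κ α n) :
    ∃ k, z ∈ auxU Z κ (Function.update α n k) (n + 1) := by
  by_contra! h
  obtain ⟨N, hN, hzN, hC⟩ := hzU
  have key : ∀ k : ℕ, ∃ C : Set K, IsCompact C ∧ C ⊆ N ∩ Metric.ball z (1 / ((k : ℝ) + 1)) ∧
      C ⊆ Z ∧ ∀ β : ℕ → ℕ, (∀ i < n + 1, β i ≤ Function.update α n k i) → ¬ C ⊆ κ β := by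
    intro k
    by_contra! hk
    exact h k ⟨N ∩ Metric.ball z (1 / ((k : ℝ) + 1)), hN.inter Metric.isOpen_ball,
      ⟨hzN, Metric.mem_ball_self (by positivity)⟩, hk⟩
  choose C hCc hCN hCZ hCn using key
  obtain ⟨β, hβ, hsub⟩ := hC _ (aux_compact_union z C hCc fun k => (hCN k).trans inter_subset_right)
    (insert_subset hzN (iUnion_subset fun k => (hCN k).trans inter_subset_left))
    (insert_subset hz (iUnion_subset hCZ))
  refine hCn (β n) β ?_ (((subset_iUnion C (β n)).trans (subset_insert _ _)).trans hsub)
  intro i hi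
  by_cases hin : i = n
  · subst hin; simp
  · rw [Function.update_of_ne hin]; exact hβ i (by omega)

/-- Point-finite shrinking of the sets `auxU`. -/
def auxV {K : Type*} [MetricSpace K] (Z : Set K) (κ : (ℕ → ℕ) → Set K)
    (α : ℕ → ℕ) (n : ℕ) : Set K :=
  auxU Z κ α (n + 1) ∩ {x | α n = 0 ∨
    ∃ y, y ∉ auxU Z κ (Function.update α n (α n - 1)) (n + 1) ∧ dist x y < 1 / (α n : ℝ)}

open Set Filter Topology in
lemma auxV_open {K : Type*} [MetricSpace K] (Z : Set K) (κ : (ℕ → ℕ) → Set K)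
    (α : ℕ → ℕ) (n : ℕ) : IsOpen (auxV Z κ α n) := by
  refine (auxU_open Z κ α (n + 1)).inter ?_
  have : {x : K | α n = 0 ∨
    ∃ y, y ∉ auxU Z κ (Function.update α n (α n - 1)) (n + 1) ∧ dist x y < 1 / (α n : ℝ)} =
    {x : K | α n = 0} ∪ ⋃ y ∈ (auxU Z κ (Function.update α n (α n - 1)) (n + 1))ᶜ,
      Metric.ball y (1 / (α n : ℝ)) := by
    ext x; simp
  rw [this]
  exact isOpen_const.union (isOpen_biUnion fun _ _ => Metric.isOpen_ball)

lemma auxV_congr {K : Type*} [MetricSpace K] (Z : Set K) (κ : (ℕ → ℕ) → Set K)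
    {α α' : ℕ → ℕ} {n : ℕ} (h : ∀ i < n + 1, α i = α' i) : auxV Z κ α n = auxV Z κ α' n := by
  have h1 := auxU_congr Z κ h
  have hn := h n (by omega)
  have h2 : auxU Z κ (Function.update α n (α' n - 1)) (n + 1) =
      auxU Z κ (Function.update α' n (α' n - 1)) (n + 1) := by
    apply auxU_congr
    intro i hi
    by_cases hin : i = n
    · subst hin; simp
    · simp [Function.update_of_ne hin, h i hi]
  unfold auxV
  rw [h1, hn, h2]

open Set Filter Topology in
lemma auxV_bound {K : Type*} [MetricSpace K] (Z : Set K) (κ : (ℕ → ℕ) → Set K)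
    (α : ℕ → ℕ) (n : ℕ) (w : K) :
    ∃ b : ℕ, ∀ k, w ∈ auxV Z κ (Function.update α n k) n → k ≤ b := by
  by_cases h : ∃ j, w ∈ auxU Z κ (Function.update α n j) (n + 1)
  · obtain ⟨j, hj⟩ := h
    obtain ⟨ε, hε, hball⟩ := Metric.isOpen_iff.1 (auxU_open Z κ _ _) w hj
    obtain ⟨m, hm⟩ := exists_nat_one_div_lt hε
    refine ⟨max j m, fun k hk => ?_⟩
    by_contra! hlt
    have hjk : j < k := (le_max_left _ _).trans_lt hlt
    have hmk : m < k := (le_max_right _ _).trans_lt hlt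
    rcases hk.2 with h0 | ⟨y, hy, hd⟩
    · simp at h0; omega
    · simp only [Function.update_self, Function.update_idem] at hy hd
      apply hy
      have hyw : y ∈ auxU Z κ (Function.update α n j) (n + 1) := by
        apply hball
        rw [Metric.mem_ball, dist_comm]
        refine (hd.trans_le ?_).trans hm
        have : (m : ℝ) + 1 ≤ k := by exact_mod_cast hmk
        gcongr
      refine auxU_mono Z κ ?_ hyw
      intro i _
      by_cases hin : i = n
      · subst hin; simp; omega
      · simp [Function.update_of_ne hin]
  · refine ⟨0, fun k hk => absurd ⟨k, hk.1⟩ h⟩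

/-- Finite intersections of the `auxV`. -/
def auxW {K : Type*} [MetricSpace K] (Z : Set K) (κ : (ℕ → ℕ) → Set K)
    (α : ℕ → ℕ) (n : ℕ) : Set K := {x | ∀ i < n, x ∈ auxV Z κ α i}

open Set Filter Topology in
lemma auxW_open {K : Type*} [MetricSpace K] (Z : Set K) (κ : (ℕ → ℕ) → Set K)
    (α : ℕ → ℕ) (n : ℕ) : IsOpen (auxW Z κ α n) := by
  have : auxW Z κ α n = ⋂ i ∈ Finset.range n, auxV Z κ α i := by
    ext x; simp [auxW]
  rw [this]
  exact isOpen_biInter_finset fun i _ => auxV_open Z κ α i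

open Set Filter Topology in
lemma auxW_finite {K : Type*} [MetricSpace K] (Z : Set K) (κ : (ℕ → ℕ) → Set K)
    (w : K) (n : ℕ) : ∃ F : Set (ℕ → ℕ), F.Finite ∧
      ∀ α, w ∈ auxW Z κ α n → ∃ α' ∈ F, ∀ i < n, α i = α' i := by
  induction n with
  | zero => exact ⟨{0}, finite_singleton _, fun α _ => ⟨0, rfl, by simp⟩⟩
  | succ n ih =>
    obtain ⟨F, hF, h⟩ := ih
    choose b hb using fun α => auxV_bound Z κ α n w
    refine ⟨⋃ α' ∈ F, (fun k => Function.update α' n k) '' Iic (b α'),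
      hF.biUnion fun α' _ => (finite_Iic _).image _, fun α hα => ?_⟩
    obtain ⟨α', hα', heq⟩ := h α fun i hi => hα i (by omega)
    have hag : ∀ i < n + 1, α i = Function.update α' n (α n) i := by
      intro i hi
      by_cases hin : i = n
      · subst hin; simp
      · rw [Function.update_of_ne hin]; exact heq i (by omega)
    have hV := hα n (by omega)
    rw [auxV_congr Z κ hag] at hV
    exact ⟨_, mem_biUnion hα' ⟨α n, hb α' _ hV, rfl⟩, hag⟩

open Set Filter Topology in
/-- Christensen-type lemma: a set whose compact subsets are `ω^ω`-dominated is `Gδ`. -/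
lemma aux_christensen {K : Type*} [MetricSpace K] (Z : Set K) (κ : (ℕ → ℕ) → Set K)
    (hmono : Monotone κ) (hcl : ∀ α, IsClosed (κ α)) (hsub : ∀ α, κ α ⊆ Z)
    (hcof : ∀ C, IsCompact C → C ⊆ Z → ∃ α, C ⊆ κ α) : IsGδ Z := by
  have hZ : Z = closure Z ∩ ⋂ n : ℕ, ⋃ α, auxW Z κ α n := by
    apply Subset.antisymm
    · intro z hz
      refine ⟨subset_closure hz, mem_iInter.2 fun n => ?_⟩
      rw [mem_iUnion]
      induction n with
      | zero => exact ⟨0, fun i hi => absurd hi (Nat.not_lt_zero _)⟩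
      | succ n ih =>
        classical
        obtain ⟨α, hα⟩ := ih
        have hU : z ∈ auxU Z κ α n := by
          cases n with
          | zero =>
            refine ⟨univ, isOpen_univ, mem_univ _, fun C h1 _ h3 => ?_⟩
            obtain ⟨β, hβ⟩ := hcof C h1 h3
            exact ⟨β, by simp, hβ⟩
          | succ m => exact (hα m (by omega)).1
        have hex := auxU_step Z κ α n hz hU
        refine ⟨Function.update α n (Nat.find hex), fun i hi => ?_⟩
        by_cases hin : i = n
        · subst hin
          refine ⟨Nat.find_spec hex, ?_⟩
          by_cases h0 : Nat.find hex = 0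
          · left; simp only [Function.update_self]; exact h0
          · right
            refine ⟨z, ?_, ?_⟩
            · simp only [Function.update_self, Function.update_idem]
              exact Nat.find_min hex (by omega)
            · simp only [Function.update_self, dist_self]
              have : 0 < Nat.find hex := Nat.pos_of_ne_zero h0
              positivity
        · have := hα i (by omega)
          rwa [auxV_congr Z κ (α' := α)]
          intro j hj
          rw [Function.update_of_ne (by omega)]
    · rintro w ⟨hwcl, hw⟩
      have hb : ∀ n : ℕ, ∃ b : ℕ, ∀ α, w ∈ auxW Z κ α (n + 1) → α n ≤ b := by
        intro n
        obtain ⟨F, hF, h⟩ := auxW_finite Z κ w (n + 1)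
        obtain ⟨b, hb⟩ := (hF.image fun α => α n).bddAbove
        refine ⟨b, fun α hα => ?_⟩
        obtain ⟨α', hα', heq⟩ := h α hα
        rw [heq n (by omega)]
        exact hb ⟨α', hα', rfl⟩
      choose b hb using hb
      have hU : ∀ n, w ∈ auxU Z κ b (n + 1) := by
        intro n
        obtain ⟨α, hα⟩ := mem_iUnion.1 (mem_iInter.1 hw (n + 1))
        refine auxU_mono Z κ ?_ (hα n (by omega)).1
        intro i hi
        exact hb i α fun j hj => hα j (by omega)
      have key : ∀ n : ℕ, ∃ z : K, ∃ β : ℕ → ℕ, dist w z < 1 / ((n : ℝ) + 1) ∧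
          (∀ i < n, β i ≤ b i) ∧ z ∈ κ β := by
        intro n
        obtain ⟨N, hN, hwN, hC⟩ := hU n
        obtain ⟨z, ⟨hzN, hzb⟩, hzZ⟩ := mem_closure_iff.1 hwcl
          (N ∩ Metric.ball w (1 / ((n : ℝ) + 1))) (hN.inter Metric.isOpen_ball)
          ⟨hwN, Metric.mem_ball_self (by positivity)⟩
        obtain ⟨β, hβ, hz⟩ := hC {z} isCompact_singleton (singleton_subset_iff.2 hzN)
          (singleton_subset_iff.2 hzZ)
        exact ⟨z, β, by rw [dist_comm]; exact hzb, fun i hi => hβ i (by omega),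
          singleton_subset_iff.1 hz⟩
      choose z β hd hβ hz using key
      let γ : ℕ → ℕ := fun i => b i + ∑ n ∈ Finset.range (i + 1), β n i
      have hle : ∀ n, β n ≤ γ := by
        intro n i
        by_cases hi : i < n
        · exact (hβ n i hi).trans (Nat.le_add_right _ _)
        · have := Finset.single_le_sum (f := fun n => β n i) (s := Finset.range (i + 1))
            (fun _ _ => Nat.zero_le _) (Finset.mem_range.2 (by omega : n < i + 1))
          exact this.trans (Nat.le_add_left _ _)
      apply hsub γ
      rw [← (hcl γ).closure_eq, Metric.mem_closure_iff]
      intro ε hε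
      obtain ⟨m, hm⟩ := exists_nat_one_div_lt hε
      exact ⟨z m, hmono (hle m) (hz m), (hd m).trans hm⟩
  rw [hZ]
  exact isClosed_closure.isGδ.inter
    (IsGδ.iInter_of_isOpen fun n => isOpen_iUnion fun α => auxW_open Z κ α n)

open Set Filter Topology in
lemma aux_embed {Y K : Type*} [TopologicalSpace Y] [MetricSpace K] [CompactSpace K]
    (φ : (ℕ → ℕ) → Y → ℝ) (hφ : Monotone φ)
    (hdom : ∀ g : C(Y, ℝ), ∃ α, ∀ y, g y ≤ φ α y) (e : Y → K) (he : Continuous e) :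
    IsSigmaCompact (range e) := by
  let κ : (ℕ → ℕ) → Set K := fun α => {x | ∀ y, 1 / max 1 (φ α y) ≤ dist x (e y)}
  have hG : IsGδ (range e)ᶜ := by
    refine aux_christensen _ κ ?_ ?_ ?_ ?_
    · intro α β hαβ x hx y
      refine le_trans ?_ (hx y)
      have := hφ hαβ y
      have h1 : (0 : ℝ) < max 1 (φ α y) := lt_of_lt_of_le one_pos (le_max_left _ _)
      gcongr
    · intro α
      have : κ α = ⋂ y, {x | 1 / max 1 (φ α y) ≤ dist x (e y)} := by ext; simp [κ]
      rw [this]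
      exact isClosed_iInter fun y => isClosed_le continuous_const (by fun_prop)
    · rintro α x hx ⟨y, rfl⟩
      have h := hx y
      have h1 : (0 : ℝ) < max 1 (φ α y) := lt_of_lt_of_le one_pos (le_max_left _ _)
      rw [dist_self] at h
      exact absurd h (not_le.2 (by positivity))
    · intro C hC hCZ
      rcases C.eq_empty_or_nonempty with rfl | hne
      · exact ⟨0, empty_subset _⟩
      have hpos : ∀ y, 0 < Metric.infDist (e y) C := fun y =>
        (hC.isClosed.notMem_iff_infDist_pos hne).1 fun h => hCZ h ⟨y, rfl⟩
      obtain ⟨α, hα⟩ := hdom ⟨fun y => (Metric.infDist (e y) C)⁻¹,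
        ((Metric.continuous_infDist_pt C).comp he).inv₀ fun y => (hpos y).ne'⟩
      refine ⟨α, fun x hx y => ?_⟩
      have h1 : (Metric.infDist (e y) C)⁻¹ ≤ max 1 (φ α y) := (hα y).trans (le_max_right _ _)
      have h2 : Metric.infDist (e y) C ≤ dist x (e y) := by
        rw [dist_comm]; exact Metric.infDist_le_dist_of_mem hx
      refine le_trans ?_ h2
      rw [one_div]
      exact inv_le_of_inv_le₀ (hpos y) h1
  obtain ⟨O, hO, hOeq⟩ := isGδ_iff_eq_iInter_nat.1 hG
  refine ⟨fun n => (O n)ᶜ, fun n => (hO n).isClosed_compl.isCompact, ?_⟩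
  rw [← compl_iInter, ← hOeq, compl_compl]

open Set Filter Topology in
lemma aux_comp {X : Type*} [UniformSpace X] {M : Type*} [MetricSpace M] (f : X → M)
    (hf : OmegaContinuous f) (g : C(range f, ℝ)) :
    OmegaContinuous (fun x => g ⟨f x, mem_range_self x⟩) := by
  intro ε hε
  choose 𝒱 hc hu h using fun n : ℕ => hf (1 / ((n : ℝ) + 1)) (by positivity)
  refine ⟨⋃ n, 𝒱 n, countable_iUnion hc, ?_, fun x => ?_⟩
  · intro V hV
    obtain ⟨n, hn⟩ := mem_iUnion.1 hV
    exact hu n V hn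
  · obtain ⟨δ, hδ, hg⟩ := Metric.continuous_iff.1 g.continuous ⟨f x, mem_range_self x⟩ ε hε
    obtain ⟨m, hm⟩ := exists_nat_one_div_lt hδ
    obtain ⟨V, hV, hVx⟩ := h m x
    refine ⟨V, mem_iUnion.2 ⟨m, hV⟩, fun y hy => hg ⟨f y, mem_range_self y⟩ ?_⟩
    exact (hVx y hy).trans hm

/-- If the set `C_ω(X)` of ω-continuous real functions on a uniform space `X` is
`ω^ω`-dominated in `ℝ^X`, then the image of any ω-continuous map of `X` into a metric
space is σ-compact. -/
theorem sigmaCompact_image_of_omegaContinuous_dominated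
    {X : Type*} [UniformSpace X]
    (hdom : ∃ φ : (ℕ → ℕ) → (X → ℝ), Monotone φ ∧
      ∀ f : X → ℝ, OmegaContinuous f → ∃ α : ℕ → ℕ, f ≤ φ α)
    {M : Type*} [MetricSpace M] (f : X → M) (hf : OmegaContinuous f) :
    IsSigmaCompact (Set.range f) := by
  obtain ⟨φ, hφ, hdom⟩ := hdom
  choose r hr using fun y : Set.range f => y.2
  let Φ : (ℕ → ℕ) → Set.range f → ℝ := fun α y => φ α (r y)
  have hΦ : Monotone Φ := fun α β h y => hφ h (r y)
  have hd : ∀ g : C(Set.range f, ℝ), ∃ α, ∀ y, g y ≤ Φ α y := by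
    intro g
    obtain ⟨α, hα⟩ := hdom _ (aux_comp f hf g)
    refine ⟨α, fun y => ?_⟩
    have h1 := hα (r y)
    have h2 : (⟨f (r y), Set.mem_range_self (r y)⟩ : Set.range f) = y := Subtype.ext (hr y)
    simp only [h2] at h1
    exact h1
  have hsc : SecondCountableTopology (Set.range f) := aux_separable Φ hΦ hd
  obtain ⟨F, hF⟩ := Metric.PiNatEmbed.exists_embedding_to_hilbert_cube (X := Set.range f)
  letI : MetricSpace (ℕ → unitInterval) := TopologicalSpace.metrizableSpaceMetric _
  have hσ : IsSigmaCompact (Set.range F) := aux_embed Φ hΦ hd F hF.continuous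
  rw [← Set.image_univ, ← hF.isSigmaCompact_iff] at hσ
  exact isSigmaCompact_iff_isSigmaCompact_univ.2 hσ
end

section
/- Let X be a topological space such that the set C(X) of continuous real-valued functions on X is ω^ω-dominated in ℝ^X. Then for every metrizable topological space M and every continuous map f : X → M, the image f(X) is σ-compact. -/
open Set Filter Topology

namespace SigmaDom

/-- Functions agreeing with `α` on longer and longer initial segments have a common bound. -/
lemma exists_bound (α : ℕ → ℕ) (β : ℕ → ℕ → ℕ) (h : ∀ k, ∀ i < k, β k i = α i) :
    ∃ γ : ℕ → ℕ, ∀ k, β k ≤ γ := by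
  refine ⟨fun i => α i + ∑ k ∈ Finset.range (i + 1), β k i, fun k i => ?_⟩
  by_cases hik : i < k
  · rw [h k i hik]; exact Nat.le_add_right _ _
  · have h1 : β k i ≤ ∑ k ∈ Finset.range (i + 1), β k i :=
      Finset.single_le_sum (f := fun k => β k i) (fun _ _ => Nat.zero_le _)
        (Finset.mem_range.2 (by omega))
    show β k i ≤ α i + ∑ k ∈ Finset.range (i + 1), β k i
    omega

lemma map_range_eq {α β : ℕ → ℕ} {n : ℕ}
    (h : (List.range n).map β = (List.range n).map α) : ∀ i < n, β i = α i := by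
  intro i hi
  have := List.map_inj_left.1 h i (List.mem_range.2 hi)
  exact this

/-- From uncountably many elements of `ω^ω` one can extract an infinite bounded family. -/
lemma exists_bounded_seq {I : Type*} (hI : ¬ (univ : Set I).Countable) (a : I → ℕ → ℕ) :
    ∃ ξ : ℕ → I, Function.Injective ξ ∧ ∃ γ : ℕ → ℕ, ∀ k, a (ξ k) ≤ γ := by
  classical
  have h1 : ∃ α : ℕ → ℕ, ∀ n, ¬ {x : I | (List.range n).map (a x) = (List.range n).map α}.Countable := by
    by_contra! hcon
    apply hI
    have : (univ : Set I) ⊆ ⋃ s : {s : List ℕ // {x : I | (List.range s.length).map (a x) = s}.Countable},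
        {x : I | (List.range s.1.length).map (a x) = s.1} := by
      intro x _
      obtain ⟨n, hn⟩ := hcon (a x)
      refine mem_iUnion.2 ⟨⟨(List.range n).map (a x), ?_⟩, ?_⟩
      · simpa using hn
      · simp
    exact (countable_iUnion fun s => s.2).mono this
  obtain ⟨α, hα⟩ := h1
  obtain ⟨p, hp, hp'⟩ := exists_seq_of_forall_finset_exists
    (fun p : I × ℕ => (List.range p.2).map (a p.1) = (List.range p.2).map α)
    (fun p q => p.2 < q.2 ∧ p.1 ≠ q.1) (by
      intro s _
      obtain ⟨x, hx, hxs⟩ : ∃ x ∈ {x : I | (List.range (s.sup Prod.snd + 1)).map (a x)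
          = (List.range (s.sup Prod.snd + 1)).map α}, x ∉ s.image Prod.fst := by
        by_contra! hcon
        exact hα (s.sup Prod.snd + 1) ((s.image Prod.fst).countable_toSet.mono
          fun x hx => hcon x hx)
      refine ⟨(x, s.sup Prod.snd + 1), hx, fun q hq => ⟨?_, ?_⟩⟩
      · exact Nat.lt_succ_of_le (Finset.le_sup (f := Prod.snd) hq)
      · rintro rfl
        exact hxs (Finset.mem_image_of_mem _ hq))
  have hmono : StrictMono fun k => (p k).2 := fun m n hmn => (hp' m n hmn).1
  refine ⟨fun k => (p k).1, ?_, ?_⟩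
  · intro m n hmn
    rcases lt_trichotomy m n with h | h | h
    · exact absurd hmn (hp' m n h).2
    · exact h
    · exact absurd hmn.symm (hp' n m h).2
  · apply exists_bound α
    intro k i hi
    exact map_range_eq (hp k) i (hi.trans_le (hmono.le_apply))

/-- Every uncountable type contains a set that looks like `ω₁`. -/
lemma exists_omega_one {D : Type*} (hD : ¬ (univ : Set D).Countable) :
    ∃ (I : Set D) (r : D → D → Prop), ¬ I.Countable ∧
      (∀ x ∈ I, {y ∈ I | r y x}.Countable) ∧
      ∀ S : Set D, S ⊆ I → S.Countable → ∃ x ∈ I, ∀ y ∈ S, r y x := by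
  classical
  obtain ⟨I, hI, hc⟩ : ∃ I : Set D, ¬ I.Countable ∧
      ∀ x ∈ I, {y ∈ I | WellOrderingRel y x}.Countable := by
    by_cases h : ∃ x : D, ¬ {y : D | WellOrderingRel y x}.Countable
    · have wf : WellFounded (WellOrderingRel : D → D → Prop) :=
        IsWellFounded.wf
      obtain ⟨x, hx, hmin⟩ := wf.has_min {x : D | ¬ {y : D | WellOrderingRel y x}.Countable} h
      refine ⟨_, hx, fun y hy => ?_⟩
      by_contra hcon
      exact hmin y (fun hc => hcon (hc.mono fun z hz => hz.2)) hy
    · push Not at h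
      exact ⟨univ, hD, fun x _ => (h x).mono fun y hy => hy.2⟩
  refine ⟨I, WellOrderingRel, hI, hc, fun S hS hSc => ?_⟩
  by_contra! hcon
  apply hI
  have : I ⊆ S ∪ ⋃ y ∈ S, {z ∈ I | WellOrderingRel z y} := by
    intro x hx
    obtain ⟨y, hyS, hy⟩ := hcon x hx
    rcases trichotomous_of WellOrderingRel x y with h | h | h
    · exact Or.inr (mem_biUnion hyS ⟨hx, h⟩)
    · exact Or.inl (h ▸ hyS)
    · exact absurd h hy
  exact (hSc.union (hSc.biUnion fun y hy => hc y (hS hy))).mono this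

/-- `ℝ^D` is not `ω^ω`-dominated for uncountable `D`. -/
lemma countable_of_dominated {D : Type*} (φ : (ℕ → ℕ) → D → ℝ) (hφ : Monotone φ)
    (h : ∀ f : D → ℝ, ∃ α, f ≤ φ α) : (univ : Set D).Countable := by
  classical
  by_contra hD
  obtain ⟨I, r, hI, hc, hS⟩ := exists_omega_one hD
  have hinj : ∀ x : D, ∃ e : D → ℕ, x ∈ I → InjOn e {y ∈ I | r y x} := by
    intro x
    by_cases hx : x ∈ I
    · obtain ⟨e, he⟩ := Set.countable_iff_exists_injOn.1 (hc x hx)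
      exact ⟨e, fun _ => he⟩
    · exact ⟨fun _ => 0, fun h => absurd h hx⟩
  choose e he using hinj
  choose a ha using fun ξ : I => h (fun x => (e x ξ : ℝ))
  obtain ⟨ξ, hξ, γ, hγ⟩ := exists_bounded_seq
    (fun hcon => hI (countable_coe_iff.1 (countable_univ_iff.1 hcon))) a
  obtain ⟨x, hxI, hx⟩ := hS (range fun k => (ξ k : D)) (by rintro _ ⟨k, rfl⟩; exact (ξ k).2)
    (countable_range _)
  have hbd : ∀ k, (e x (ξ k) : ℝ) ≤ φ γ x := fun k => (ha (ξ k) x).trans (hφ (hγ k) x)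
  obtain ⟨N, hN⟩ := exists_nat_ge (φ γ x)
  have hinj : Function.Injective fun k => e x (ξ k) := by
    intro k l hkl
    exact hξ (Subtype.ext (he x hxI ⟨(ξ k).2, hx _ ⟨k, rfl⟩⟩ ⟨(ξ l).2, hx _ ⟨l, rfl⟩⟩ hkl))
  have hfin : (range fun k => e x (ξ k)).Finite := by
    refine (finite_Iic N).subset ?_
    rintro _ ⟨k, rfl⟩
    exact_mod_cast (hbd k).trans hN
  exact infinite_range_of_injective hinj hfin

lemma secondCountable {Y : Type*} [MetricSpace Y] (φ : (ℕ → ℕ) → Y → ℝ) (hφ : Monotone φ)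
    (h : ∀ f : Y → ℝ, Continuous f → ∃ α, f ≤ φ α) : SecondCountableTopology Y := by
  apply Metric.secondCountable_of_almost_dense_set
  intro ε hε
  obtain ⟨D, hD⟩ : ∃ D : Set Y, Maximal (fun D : Set Y => D.Pairwise fun x y => ε < dist x y) D := by
    have := zorn_subset {D : Set Y | D.Pairwise fun x y => ε < dist x y} (by
      intro c hc hchain
      refine ⟨⋃₀ c, ?_, fun s hs => subset_sUnion_of_mem hs⟩
      exact (pairwise_sUnion hchain.directedOn).2 fun s hs => hc hs)
    exact this
  have hsep : D.Pairwise fun x y => ε < dist x y := hD.1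
  refine ⟨D, ?_, fun x => ?_⟩
  · have hcl : IsClosed D := by
      refine Metric.isClosed_of_pairwise_le_dist hε fun x hx y hy hxy => (hsep hx hy hxy).le
    have hdisc : DiscreteTopology D := by
      refine DiscreteTopology.of_forall_le_dist hε ?_
      intro x y hxy
      exact (hsep x.2 y.2 (fun h => hxy (Subtype.ext h))).le
    have := countable_of_dominated (fun α (d : D) => φ α d) (fun α β hab d => hφ hab d) (by
      intro f
      obtain ⟨g, hg⟩ := ContinuousMap.exists_restrict_eq hcl
        (⟨f, continuous_of_discreteTopology⟩ : C(D, ℝ))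
      obtain ⟨α, hα⟩ := h g g.continuous
      refine ⟨α, fun d => ?_⟩
      have h1 : g d = f d := congrArg (fun k : C(D, ℝ) => k d) hg
      rw [← h1]
      exact hα d)
    exact countable_coe_iff.1 (countable_univ_iff.1 this)
  · by_contra! hcon
    have hx : x ∈ D := by
      refine hD.2 (y := insert x D) ?_ (subset_insert _ _) (mem_insert _ _)
      refine hsep.insert fun y hy _ => ⟨hcon y hy, ?_⟩
      rw [dist_comm]; exact hcon y hy
    have := hcon x hx
    rw [dist_self] at this
    linarith

section Christensen

variable {K : Type*} [MetricSpace K]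

/-- Compact subsets of `V ∩ Z` are absorbed by the `A β`, `β` extending `s`. -/
def Good (Z : Set K) (A : (ℕ → ℕ) → Set K) (V : Set K) (s : List ℕ) : Prop :=
  ∀ L, IsCompact L → L ⊆ V → L ⊆ Z → ∃ β : ℕ → ℕ, (List.range s.length).map β = s ∧ L ⊆ A β

lemma isCompact_fan (x : K) (L : ℕ → Set K) (hL : ∀ n, IsCompact (L n))
    (h : ∀ n, L n ⊆ Metric.ball x (1 / (n + 1))) : IsCompact (insert x (⋃ n, L n)) := by
  rw [isCompact_iff_ultrafilter_le_nhds]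
  intro F hF
  rw [le_principal_iff] at hF
  by_cases hn : ∃ n, L n ∈ F
  · obtain ⟨n, hn⟩ := hn
    obtain ⟨y, hy, hFy⟩ := isCompact_iff_ultrafilter_le_nhds.1 (hL n) F (le_principal_iff.2 hn)
    exact ⟨y, Or.inr (mem_iUnion.2 ⟨n, hy⟩), hFy⟩
  · push Not at hn
    refine ⟨x, mem_insert _ _, ?_⟩
    rw [Metric.nhds_basis_ball.ge_iff]
    intro ε hε
    obtain ⟨N, hN⟩ := exists_nat_one_div_lt hε
    have h1 : (⋂ n ∈ Finset.range N, (L n)ᶜ) ∈ F :=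
      (Filter.biInter_finset_mem _).2 fun n _ => Ultrafilter.compl_mem_iff_notMem.2 (hn n)
    filter_upwards [hF, h1] with y hy hy'
    rcases hy with rfl | hy
    · exact Metric.mem_ball_self hε
    · obtain ⟨n, hyn⟩ := mem_iUnion.1 hy
      have hnN : N ≤ n := by
        by_contra! hlt
        exact mem_iInter₂.1 hy' n (Finset.mem_range.2 hlt) hyn
      have := h n hyn
      rw [Metric.mem_ball] at this ⊢
      refine (this.trans_le ?_).trans hN
      apply one_div_le_one_div_of_le
      · positivity
      · have : (N : ℝ) ≤ n := by exact_mod_cast hnN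
        linarith

lemma good_step {Z : Set K} {A : (ℕ → ℕ) → Set K} {B : Set (Set K)}
    (hB : TopologicalSpace.IsTopologicalBasis B) {V : Set K} (hV : IsOpen V) {s : List ℕ}
    (hs : Good Z A V s) {x : K} (hxV : x ∈ V) (hxZ : x ∈ Z) {ε : ℝ} (hε : 0 < ε) :
    ∃ W ∈ B, ∃ n, x ∈ W ∧ W ⊆ V ∧ W ⊆ Metric.ball x ε ∧ Good Z A W (s ++ [n]) := by
  by_contra! hcon
  have hW : ∀ n : ℕ, ∃ W ∈ B, x ∈ W ∧ W ⊆ V ∩ Metric.ball x ε ∩ Metric.ball x (1 / (n + 1)) := by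
    intro n
    have h0 : (0 : ℝ) < 1 / (n + 1) := by positivity
    exact hB.exists_subset_of_mem_open
      ⟨⟨hxV, Metric.mem_ball_self hε⟩, Metric.mem_ball_self h0⟩
      ((hV.inter Metric.isOpen_ball).inter Metric.isOpen_ball)
  choose W hWB hxW hWs using hW
  have hbad : ∀ n, ¬ Good Z A (W n) (s ++ [n]) := fun n =>
    hcon (W n) (hWB n) n (hxW n) (fun y hy => (hWs n hy).1.1) (fun y hy => (hWs n hy).1.2)
  unfold Good at hbad
  push Not at hbad
  choose L hLc hLW hLZ hLb using hbad
  obtain ⟨β, hβ, hLβ⟩ := hs (insert x (⋃ n, L n))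
    (isCompact_fan x L hLc fun n y hy => (hWs n (hLW n hy)).2)
    (insert_subset hxV (iUnion_subset fun n y hy => (hWs n (hLW n hy)).1.1))
    (insert_subset hxZ (iUnion_subset hLZ))
  refine hLb (β s.length) β ?_
    ((subset_iUnion L _).trans ((subset_insert _ _).trans hLβ))
  rw [List.length_append, List.length_singleton, List.range_succ, List.map_append, hβ]
  simp

lemma christensen [CompactSpace K] (Z : Set K) (A : (ℕ → ℕ) → Set K) (hA : Monotone A)
    (hAc : ∀ α, IsClosed (A α)) (hAZ : ∀ α, A α ⊆ Z)
    (hcof : ∀ L, IsCompact L → L ⊆ Z → ∃ α, L ⊆ A α) : IsSigmaCompact Zᶜ := by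
  classical
  obtain ⟨B, hBc, -, hB⟩ := TopologicalSpace.exists_countable_basis K
  let B' : Set (Set K) := insert univ B
  have hB'o : ∀ V ∈ B', IsOpen V := by
    rintro V (rfl | hV)
    · exact isOpen_univ
    · exact hB.isOpen hV
  -- the successors of a pair `(V, s)`
  let N : Set K → List ℕ → Set (Set K) := fun V s =>
    {W | W ∈ B ∧ W ⊆ V ∧ (W ∩ Z).Nonempty ∧ (∃ x, W ⊆ Metric.ball x (1 / (s.length + 1))) ∧
      ∃ n, Good Z A W (s ++ [n])}
  have hNo : ∀ V s, IsOpen (⋃₀ N V s) := fun V s => isOpen_sUnion fun W hW => hB.isOpen hW.1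
  let J := {p : B' × List ℕ // Good Z A p.1 p.2}
  have : Countable B' := (hBc.insert univ).to_subtype
  have key : Zᶜ = ⋃ p : J, ((p.1.1 : Set K) \ ⋃₀ N p.1.1 p.1.2) := by
    apply Subset.antisymm
    · intro z hz
      by_contra hcon
      have hcon' : ∀ V ∈ B', ∀ s, Good Z A V s → z ∈ V → ∃ W ∈ N V s, z ∈ W := by
        intro V hV s hg hzV
        by_contra hW
        exact hcon (mem_iUnion.2 ⟨⟨(⟨V, hV⟩, s), hg⟩, hzV, hW⟩)
      apply hz
      let T := {p : Set K × List ℕ // p.1 ∈ B' ∧ Good Z A p.1 p.2 ∧ z ∈ p.1}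
      have hstep : ∀ t : T, ∃ t' : T, (∃ n, t'.1.2 = t.1.2 ++ [n]) ∧
          (t'.1.1 ∩ Z).Nonempty ∧ ∃ x, t'.1.1 ⊆ Metric.ball x (1 / (t.1.2.length + 1)) := by
        rintro ⟨⟨V, s⟩, hV, hg, hzV⟩
        obtain ⟨W, ⟨hWB, hWV, hWZ, hWx, n, hn⟩, hzW⟩ := hcon' V hV s hg hzV
        exact ⟨⟨(W, s ++ [n]), Or.inr hWB, hn, hzW⟩, ⟨n, rfl⟩, hWZ, hWx⟩
      choose nx hnx1 hnx2 hnx3 using hstep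
      choose m hm using hnx1
      let t0 : T := ⟨(univ, []), Or.inl rfl, (by
        intro L hL _ hLZ
        obtain ⟨α, hα⟩ := hcof L hL hLZ
        exact ⟨α, rfl, hα⟩), mem_univ _⟩
      let t : ℕ → T := fun k => Nat.rec t0 (fun _ t => nx t) k
      have ht : ∀ k, t (k + 1) = nx (t k) := fun k => rfl
      let α : ℕ → ℕ := fun k => m (t k)
      have hts : ∀ k, (t k).1.2 = (List.range k).map α := by
        intro k
        induction k with
        | zero => rfl
        | succ k ih => rw [ht, hm, ih, List.range_succ, List.map_append]; rfl
      have hlen : ∀ k, (t k).1.2.length = k := fun k => by rw [hts]; simp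
      choose x hxt hxZ using fun k => hnx2 (t k)
      have hβ : ∀ k, ∃ β : ℕ → ℕ, (List.range k).map β = (List.range k).map α ∧ x k ∈ A β := by
        intro k
        obtain ⟨β, hβ, hxβ⟩ := (t (k + 1)).2.2.1 {x k} isCompact_singleton
          (singleton_subset_iff.2 (hxt k)) (singleton_subset_iff.2 (hxZ k))
        have hl := hlen (k + 1)
        have hs := hts (k + 1)
        replace hβ : (List.range (k + 1)).map β = (List.range (k + 1)).map α :=
          (congrArg (fun j => (List.range j).map β) hl).symm.trans (hβ.trans hs)
        refine ⟨β, ?_, hxβ rfl⟩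
        rw [List.map_inj_left] at hβ ⊢
        intro a ha
        exact hβ a (List.mem_range.2 ((List.mem_range.1 ha).trans (Nat.lt_succ_self k)))
      choose β hβα hxβ using hβ
      obtain ⟨γ, hγ⟩ := exists_bound α β fun k => map_range_eq (hβα k)
      have hlim : Tendsto x atTop (𝓝 z) := by
        rw [tendsto_iff_dist_tendsto_zero]
        have h2 : Tendsto (fun k : ℕ => 2 * (1 / ((k : ℝ) + 1))) atTop (𝓝 0) := by
          simpa using (tendsto_one_div_add_atTop_nhds_zero_nat (𝕜 := ℝ)).const_mul 2
        refine squeeze_zero (fun _ => dist_nonneg) (fun k => ?_) h2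
        obtain ⟨c, hc⟩ := hnx3 (t k)
        rw [hlen] at hc
        have h3 := Metric.mem_ball.1 (hc (hxt k))
        have h4 := Metric.mem_ball.1 (hc (nx (t k)).2.2.2)
        have h5 := dist_triangle_right (x k) z c
        linarith
      exact hAZ γ ((hAc γ).mem_of_tendsto hlim (Eventually.of_forall fun k => hA (hγ k) (hxβ k)))
    · refine iUnion_subset fun p => ?_
      rintro z ⟨hzV, hz⟩ hzZ
      have h0 : (0 : ℝ) < 1 / (p.1.2.length + 1) := by positivity
      obtain ⟨W, hWB, n, hzW, hWV, hWb, hg⟩ :=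
        good_step hB (hB'o _ p.1.1.2) p.2 hzV hzZ h0
      exact hz ⟨W, ⟨hWB, hWV, ⟨z, hzW, hzZ⟩, ⟨z, hWb⟩, n, hg⟩, hzW⟩
  rw [key]
  refine isSigmaCompact_iUnion _ fun p => ?_
  obtain ⟨F, hF, -, hFV, -⟩ := (hB'o _ p.1.1.2).exists_iUnion_isClosed
  rw [← hFV, iUnion_diff]
  exact isSigmaCompact_iUnion_of_isCompact _ fun n =>
    ((hF n).sdiff (hNo _ _)).isCompact

end Christensen

lemma main {Y : Type*} [MetricSpace Y] (φ : (ℕ → ℕ) → Y → ℝ) (hφ : Monotone φ)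
    (h : ∀ f : Y → ℝ, Continuous f → ∃ α, f ≤ φ α) : IsSigmaCompact (univ : Set Y) := by
  have := secondCountable φ hφ h
  obtain ⟨e, he⟩ := Metric.PiNatEmbed.exists_embedding_to_hilbert_cube (X := Y)
  letI : MetricSpace (ℕ → unitInterval) := TopologicalSpace.metrizableSpaceMetric _
  rw [he.isSigmaCompact_iff, image_univ, ← compl_compl (range e)]
  apply christensen (range e)ᶜ (fun α => {z | ∀ y, 1 ≤ φ α y * dist z (e y)})
  · intro α β hab z hz y
    exact (hz y).trans (mul_le_mul_of_nonneg_right (hφ hab y) dist_nonneg)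
  · intro α
    simp only [setOf_forall]
    exact isClosed_iInter fun y => isClosed_le continuous_const (by fun_prop)
  · rintro α z hz ⟨y, rfl⟩
    have := hz y
    rw [dist_self, mul_zero] at this
    linarith
  · intro L hL hLZ
    rcases L.eq_empty_or_nonempty with rfl | hne
    · exact ⟨0, empty_subset _⟩
    have hpos : ∀ y, 0 < Metric.infDist (e y) L := fun y =>
      (hL.isClosed.notMem_iff_infDist_pos hne).1 fun hy => hLZ hy ⟨y, rfl⟩
    obtain ⟨α, hα⟩ := h (fun y => (Metric.infDist (e y) L)⁻¹)
      (((Metric.continuous_infDist_pt L).comp he.continuous).inv₀ fun y => (hpos y).ne')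
    refine ⟨α, fun z hz y => ?_⟩
    have h1 : Metric.infDist (e y) L ≤ dist z (e y) := by
      rw [dist_comm]; exact Metric.infDist_le_dist_of_mem hz
    calc (1 : ℝ) = (Metric.infDist (e y) L)⁻¹ * Metric.infDist (e y) L :=
          (inv_mul_cancel₀ (hpos y).ne').symm
      _ ≤ (Metric.infDist (e y) L)⁻¹ * dist z (e y) :=
          mul_le_mul_of_nonneg_left h1 (inv_nonneg.2 (hpos y).le)
      _ ≤ φ α y * dist z (e y) := mul_le_mul_of_nonneg_right (hα y) dist_nonneg

end SigmaDom

/-- If the set `C(X)` of continuous real functions on a topological space `X` is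
`ω^ω`-dominated in `ℝ^X`, then the image of `X` under any continuous map into a
metrizable topological space is σ-compact. -/
theorem sigmaCompact_image_of_continuous_dominated
    {X : Type*} [TopologicalSpace X]
    (hdom : ∃ φ : (ℕ → ℕ) → (X → ℝ), Monotone φ ∧
      ∀ f : X → ℝ, Continuous f → ∃ α : ℕ → ℕ, f ≤ φ α)
    {M : Type*} [TopologicalSpace M] [TopologicalSpace.MetrizableSpace M]
    (f : X → M) (hf : Continuous f) :
    IsSigmaCompact (Set.range f) := by
  obtain ⟨φ, hφ, h⟩ := hdom
  letI : MetricSpace M := TopologicalSpace.metrizableSpaceMetric M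
  rw [isSigmaCompact_iff_isSigmaCompact_univ]
  choose s hs using fun y : Set.range f => y.2
  refine SigmaDom.main (fun α y => φ α (s y)) (fun α β hab y => hφ hab (s y)) fun g hg => ?_
  obtain ⟨α, hα⟩ := h (fun x => g ⟨f x, x, rfl⟩) (hg.comp (hf.subtype_mk _))
  refine ⟨α, fun y => ?_⟩
  have h1 := hα (s y)
  have h2 : (⟨f (s y), s y, rfl⟩ : Set.range f) = y := Subtype.ext (hs y)
  simpa only [h2] using h1
end

section
/- Let X be a completely regular Hausdorff space whose finest compatible uniformity has a 𝔊-base, i.e., there is a uniformity 𝒰 on X inducing the topology of X such that every continuous pseudometric on X is uniformly continuous with respect to 𝒰 and 𝒰 has a 𝔊-base. If moreover the set C(X) of continuous real-valued functions on X is ω^ω-dominated in ℝ^X, then the function space C_p(X) is K-analytic, and every finite power X^n (n ∈ ℕ) of X is countably tight. -/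
/-- A topological space `Y` is K-analytic if `Y = ⋃_{α ∈ ω^ω} K_α` for compact sets
`K_α` such that `{α : K_α ⊆ U}` is open in `ω^ω` (with the product topology) for every
open `U ⊆ Y`. -/
def KAnalyticSpace (Y : Type*) [TopologicalSpace Y] : Prop :=
  ∃ K : (ℕ → ℕ) → Set Y, (∀ α, IsCompact (K α)) ∧ (⋃ α, K α) = Set.univ ∧
    ∀ U : Set Y, IsOpen U → IsOpen {α : ℕ → ℕ | K α ⊆ U}

/-- A topological space `Y` is countably tight if every point of the closure of a set
`A` lies in the closure of a countable subset of `A`. -/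
def CountablyTightSpace (Y : Type*) [TopologicalSpace Y] : Prop :=
  ∀ A : Set Y, ∀ y ∈ closure A, ∃ B ⊆ A, B.Countable ∧ y ∈ closure B

open Filter Topology Set

namespace GBaseAux

/-- A monotone compact resolution of the continuous functions. -/
def CRes (X : Type*) [TopologicalSpace X] (K : (ℕ → ℕ) → Set (X → ℝ)) : Prop :=
  Monotone K ∧ (∀ α, IsCompact (K α)) ∧ (∀ α, ∀ f ∈ K α, Continuous f) ∧
    ∀ f, Continuous f → ∃ α, f ∈ K α

/-- Union of the `K β` over `β` extending a finite sequence. -/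
def CS {X : Type*} (K : (ℕ → ℕ) → Set (X → ℝ)) (s : Σ n : ℕ, (Fin n → ℕ)) : Set (X → ℝ) :=
  {f | ∃ β : ℕ → ℕ, (∀ i : Fin s.1, β i = s.2 i) ∧ f ∈ K β}

/-- Restriction of a sequence. -/
def res (α : ℕ → ℕ) (n : ℕ) : Σ n : ℕ, (Fin n → ℕ) := ⟨n, fun i => α i⟩

/-- The upper semicontinuous envelope. -/
def LL {X : Type*} (K : (ℕ → ℕ) → Set (X → ℝ)) (α : ℕ → ℕ) : Set (X → ℝ) :=
  ⋂ n, closure (CS K (res α n))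

lemma mem_CS_res {X : Type*} {K : (ℕ → ℕ) → Set (X → ℝ)} {α : ℕ → ℕ} {n : ℕ} {f : X → ℝ} :
    f ∈ CS K (res α n) ↔ ∃ β : ℕ → ℕ, (∀ i < n, β i = α i) ∧ f ∈ K β := by
  constructor
  · rintro ⟨β, h, hf⟩
    exact ⟨β, fun i hi => h ⟨i, hi⟩, hf⟩
  · rintro ⟨β, h, hf⟩
    exact ⟨β, fun i => h i i.2, hf⟩

lemma CS_anti {X : Type*} (K : (ℕ → ℕ) → Set (X → ℝ)) (α : ℕ → ℕ) {m n : ℕ} (h : m ≤ n) :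
    CS K (res α n) ⊆ CS K (res α m) := by
  intro f hf
  rw [mem_CS_res] at hf ⊢
  obtain ⟨β, h1, h2⟩ := hf
  exact ⟨β, fun i hi => h1 i (by omega), h2⟩

lemma seq_mem {X : Type*} {K : (ℕ → ℕ) → Set (X → ℝ)} (hK : Monotone K) (α : ℕ → ℕ)
    (h : ℕ → X → ℝ) (hh : ∀ j, h j ∈ CS K (res α j)) : ∃ γ, ∀ j, h j ∈ K γ := by
  simp only [mem_CS_res] at hh
  choose β h1 h2 using hh
  refine ⟨fun i => α i + ∑ j ∈ Finset.range (i + 1), β j i, fun j => hK ?_ (h2 j)⟩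
  intro i
  by_cases hij : i < j
  · rw [h1 j i hij]; exact Nat.le_add_right _ _
  · have : β j i ≤ ∑ j ∈ Finset.range (i + 1), β j i :=
      Finset.single_le_sum (f := fun j => β j i) (fun _ _ => Nat.zero_le _)
        (Finset.mem_range.2 (by omega))
    exact this.trans (Nat.le_add_left _ _)

lemma bdd {X : Type*} [TopologicalSpace X] {K : (ℕ → ℕ) → Set (X → ℝ)} (hK : CRes X K)
    (α : ℕ → ℕ) (x : X) : ∃ n : ℕ, ∀ f ∈ CS K (res α n), |f x| ≤ (n : ℝ) := by
  by_contra! hcon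
  choose h h1 h2 using hcon
  obtain ⟨γ, hγ⟩ := seq_mem hK.1 α h h1
  have hc : IsCompact ((fun f : X → ℝ => |f x|) '' K γ) :=
    (hK.2.1 γ).image (by fun_prop)
  obtain ⟨M, hM⟩ := hc.bddAbove
  obtain ⟨n, hn⟩ := exists_nat_gt M
  have := hM ⟨h n, hγ n, rfl⟩
  have := h2 n
  simp only at *
  linarith

lemma bdd_cl {X : Type*} [TopologicalSpace X] {K : (ℕ → ℕ) → Set (X → ℝ)} (hK : CRes X K)
    (α : ℕ → ℕ) (x : X) :
    ∃ n : ℕ, ∀ f ∈ closure (CS K (res α n)), f x ∈ Icc (-(n : ℝ)) n := by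
  obtain ⟨n, hn⟩ := bdd hK α x
  refine ⟨n, fun f hf => ?_⟩
  have hcl : IsClosed {f : X → ℝ | f x ∈ Icc (-(n : ℝ)) n} :=
    isClosed_Icc.preimage (continuous_apply x)
  exact closure_minimal (fun g hg => abs_le.1 (hn g hg)) hcl hf

lemma LL_compact {X : Type*} [TopologicalSpace X] {K : (ℕ → ℕ) → Set (X → ℝ)} (hK : CRes X K)
    (α : ℕ → ℕ) : IsCompact (LL K α) := by
  choose n hn using bdd_cl hK α
  have hc : IsCompact (Set.pi univ fun x : X => Icc (-(n x : ℝ)) (n x)) :=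
    isCompact_univ_pi fun x => isCompact_Icc
  refine hc.of_isClosed_subset (isClosed_iInter fun n => isClosed_closure) ?_
  intro f hf x _
  exact hn x f (mem_iInter.1 hf _)

lemma LL_usc {X : Type*} [TopologicalSpace X] {K : (ℕ → ℕ) → Set (X → ℝ)} (hK : CRes X K)
    (α : ℕ → ℕ) (U : Set (X → ℝ)) (hU : IsOpen U) (h : LL K α ⊆ U) :
    ∃ n, closure (CS K (res α n)) ⊆ U := by
  by_contra! hcon
  set S : ℕ → Set (X → ℝ) := fun n => closure (CS K (res α n)) ∩ Uᶜ with hS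
  have hne : ∀ n, (S n).Nonempty := by
    intro n
    obtain ⟨f, hf, hf'⟩ := not_subset.1 (hcon n)
    exact ⟨f, hf, hf'⟩
  have hanti : Antitone S := fun m n hmn =>
    inter_subset_inter_left _ (closure_mono (CS_anti K α hmn))
  choose g hg using hne
  let F : Ultrafilter (X → ℝ) := (hyperfilter ℕ).map g
  have hF : ∀ n, S n ∈ F := by
    intro n
    change g ⁻¹' S n ∈ hyperfilter ℕ
    apply Nat.hyperfilter_le_atTop
    filter_upwards [eventually_ge_atTop n] with j hj
    exact hanti hj (hg j)
  have hlim : ∀ x, ∃ y : ℝ, Tendsto (fun f : X → ℝ => f x) F (𝓝 y) := by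
    intro x
    obtain ⟨n, hn⟩ := bdd_cl hK α x
    obtain ⟨y, -, hy⟩ := (isCompact_Icc (a := -(n : ℝ)) (b := n)).ultrafilter_le_nhds
      (F.map (fun f => f x)) (by
        rw [le_principal_iff]
        change (fun f : X → ℝ => f x) ⁻¹' _ ∈ F
        filter_upwards [hF n] with f hf
        exact hn f hf.1)
    exact ⟨y, hy⟩
  choose y hy using hlim
  have hty : Tendsto id (F : Filter (X → ℝ)) (𝓝 y) := tendsto_pi_nhds.2 hy
  have hmem : ∀ n, y ∈ S n := fun n =>
    (isClosed_closure.inter hU.isClosed_compl).mem_of_tendsto hty (hF n)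
  exact (hmem 0).2 (h (mem_iInter.2 fun n => (hmem n).1))

lemma isOpen_LL {X : Type*} [TopologicalSpace X] {K : (ℕ → ℕ) → Set (X → ℝ)} (hK : CRes X K)
    (U : Set (X → ℝ)) (hU : IsOpen U) : IsOpen {α | LL K α ⊆ U} := by
  rw [isOpen_iff_mem_nhds]
  intro α hα
  obtain ⟨n, hn⟩ := LL_usc hK α U hU hα
  have hev : ∀ᶠ β : ℕ → ℕ in 𝓝 α, ∀ i ∈ Finset.range n, β i = α i := by
    rw [Filter.eventually_all_finset]
    intro i _
    exact (continuous_apply i).continuousAt.eventually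
      (show ∀ᶠ y in 𝓝 (α i), y = α i by simp)
  filter_upwards [hev] with β hβ
  have : CS K (res β n) ⊆ CS K (res α n) := by
    intro f hf
    rw [mem_CS_res] at hf ⊢
    obtain ⟨δ, h1, h2⟩ := hf
    exact ⟨δ, fun i hi => (h1 i hi).trans (hβ i (Finset.mem_range.2 hi)), h2⟩
  exact (iInter_subset _ n).trans ((closure_mono this).trans hn)

/-- Elements of the countable web on `X`. -/
def NN {X : Type*} (K : (ℕ → ℕ) → Set (X → ℝ)) (T : Finset ((Σ n : ℕ, (Fin n → ℕ)) × ℕ)) :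
    Set X :=
  {x | ∀ t ∈ T, ∀ g ∈ CS K t.1, |g x| ≤ (t.2 : ℝ)}

lemma exists_dense {X : Type*} (H : Set (X → ℝ)) (hH : H.Countable) (N : Set X) :
    ∃ D : Set X, D.Countable ∧ ∀ z ∈ N, ∀ F : Finset (X → ℝ), ↑F ⊆ H → ∀ ε > 0,
      ∃ d ∈ D, d ∈ N ∧ ∀ h ∈ F, |h d - h z| < ε := by
  have : Countable H := hH
  let ψ : N → (H → ℝ) := fun x h => h.1 x.1
  let _ : TopologicalSpace N := TopologicalSpace.induced ψ inferInstance
  have : SecondCountableTopology N := TopologicalSpace.secondCountableTopology_induced _ _ _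
  obtain ⟨D, hD, hd⟩ := TopologicalSpace.exists_countable_dense N
  have hc : Continuous ψ := continuous_induced_dom
  refine ⟨Subtype.val '' D, hD.image _, fun z hz F hF ε hε => ?_⟩
  have hopen : IsOpen {x : N | ∀ h ∈ F, |h x.1 - h z| < ε} := by
    have : {x : N | ∀ h ∈ F, |h x.1 - h z| < ε} = ⋂ h ∈ F, {x : N | |h x.1 - h z| < ε} := by
      ext; simp
    rw [this]
    refine isOpen_biInter_finset fun h hh => ?_
    have h1 : Continuous fun x : N => h x.1 := (continuous_apply (⟨h, hF hh⟩ : H)).comp hc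
    exact isOpen_lt (h1.sub continuous_const).abs continuous_const
  obtain ⟨d, hd1, hd2⟩ := hd.exists_mem_open hopen ⟨⟨z, hz⟩, by intro h _; simpa using hε⟩
  exact ⟨d.1, ⟨d, hd1, rfl⟩, d.2, hd2⟩

lemma exists_dense' {X : Type*} (K : (ℕ → ℕ) → Set (X → ℝ)) (H : Set (X → ℝ))
    (hH : H.Countable) :
    ∃ D : Set X, D.Countable ∧ ∀ T, ∀ z ∈ NN K T, ∀ F : Finset (X → ℝ), ↑F ⊆ H → ∀ ε > 0,
      ∃ d ∈ D, d ∈ NN K T ∧ ∀ h ∈ F, |h d - h z| < ε := by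
  choose D hD h using fun T => exists_dense H hH (NN K T)
  refine ⟨⋃ T, D T, countable_iUnion hD, fun T z hz F hF ε hε => ?_⟩
  obtain ⟨d, h1, h2⟩ := h T z hz F hF ε hε
  exact ⟨d, mem_iUnion.2 ⟨T, h1⟩, h2⟩

/-- Countable set closed under the approximations. -/
lemma exists_closed {X : Type*} (K : (ℕ → ℕ) → Set (X → ℝ)) (f : X → ℝ) (z₀ : X)
    (G : Finset X → ℕ → X → ℝ) :
    ∃ D : Set X, D.Countable ∧ D.Nonempty ∧ ∀ T, ∀ z ∈ NN K T,
      ∀ Q : Finset (Finset X × ℕ), (∀ q ∈ Q, (↑q.1 : Set X) ⊆ D) → ∀ ε > 0,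
      ∃ d ∈ D, d ∈ NN K T ∧ |f d - f z| < ε ∧ ∀ q ∈ Q, |G q.1 q.2 d - G q.1 q.2 z| < ε := by
  classical
  let H : Set X → Set (X → ℝ) := fun D =>
    insert f ((fun q : Finset X × ℕ => G q.1 q.2) '' ({F : Finset X | (↑F : Set X) ⊆ D} ×ˢ univ))
  have hH : ∀ D : Set X, D.Countable → (H D).Countable := by
    intro D hD
    refine Countable.insert _ (Countable.image (Countable.prod ?_ countable_univ) _)
    have h0 : {S : Set X | S.Finite ∧ S ⊆ D}.Countable := Set.countable_ofPred_finite_subset hD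
    have := h0.preimage_of_injOn
      (f := fun F : Finset X => (↑F : Set X)) (Finset.coe_injective.injOn)
    refine this.mono fun F hF => ?_
    exact ⟨F.finite_toSet, hF⟩
  have step : ∀ D : Set X, ∃ D' : Set X, D ⊆ D' ∧ (D.Countable → D'.Countable ∧
      ∀ T, ∀ z ∈ NN K T, ∀ F : Finset (X → ℝ), ↑F ⊆ H D → ∀ ε > 0,
      ∃ d ∈ D', d ∈ NN K T ∧ ∀ h ∈ F, |h d - h z| < ε) := by
    intro D
    by_cases hD : D.Countable
    · obtain ⟨D', h1, h2⟩ := exists_dense' K (H D) (hH D hD)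
      refine ⟨D ∪ D', subset_union_left, fun _ => ⟨hD.union h1, fun T z hz F hF ε hε => ?_⟩⟩
      obtain ⟨d, h3, h4⟩ := h2 T z hz F hF ε hε
      exact ⟨d, Or.inr h3, h4⟩
    · exact ⟨D, Subset.rfl, fun h => absurd h hD⟩
  choose Φ hΦ1 hΦ2 using step
  let E : ℕ → Set X := fun k => Φ^[k] {z₀}
  have hEs : ∀ k, E (k + 1) = Φ (E k) := fun k => Function.iterate_succ_apply' _ _ _
  have hEc : ∀ k, (E k).Countable := by
    intro k
    induction k with
    | zero => exact countable_singleton z₀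
    | succ k ih => rw [hEs]; exact (hΦ2 _ ih).1
  have hEm : Monotone E := monotone_nat_of_le_succ fun k => by rw [hEs]; exact hΦ1 _
  refine ⟨⋃ k, E k, countable_iUnion hEc, ⟨z₀, mem_iUnion.2 ⟨0, rfl⟩⟩, ?_⟩
  intro T z hz Q hQ ε hε
  have hk : ∃ k, ∀ q ∈ Q, (↑q.1 : Set X) ⊆ E k := by
    have h1 : (↑(Q.biUnion fun q => q.1) : Set X) ⊆ ⋃ k, E k := by
      intro x hx
      simp only [Finset.coe_biUnion, mem_iUnion, Finset.mem_coe] at hx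
      obtain ⟨q, hq, hx⟩ := hx
      exact hQ q hq hx
    obtain ⟨k, hk⟩ := hEm.directed_le.exists_mem_subset_of_finset_subset_biUnion h1
    refine ⟨k, fun q hq x hx => hk ?_⟩
    simp only [Finset.coe_biUnion, mem_iUnion, Finset.mem_coe]
    exact ⟨q, hq, hx⟩
  obtain ⟨k, hk⟩ := hk
  obtain ⟨d, h1, h2, h3⟩ := (hΦ2 (E k) (hEc k)).2 T z hz
    (insert f (Q.image fun q => G q.1 q.2)) (by
      intro g hg
      simp only [Finset.coe_insert, Finset.coe_image, mem_insert_iff, mem_image,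
        Finset.mem_coe] at hg
      rcases hg with rfl | ⟨q, hq, rfl⟩
      · exact Or.inl rfl
      · exact Or.inr ⟨q, ⟨hk q hq, mem_univ _⟩, rfl⟩) ε hε
  refine ⟨d, mem_iUnion.2 ⟨k + 1, by rw [hEs]; exact h1⟩, h2, h3 f (by simp), fun q hq => ?_⟩
  exact h3 _ (Finset.mem_insert_of_mem (Finset.mem_image_of_mem (fun q => G q.1 q.2) hq))

/-- The pseudo-bounded sequence argument. -/
lemma pin {X : Type*} [TopologicalSpace X] (h : X → ℝ) (hi : ℕ → X → ℝ) (hh : Continuous h)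
    (hhi : ∀ i, Continuous (hi i)) (z : X) (c : ℝ) (d : ℕ → X)
    (hbd : ∀ g : X → ℝ, Continuous g → ∃ M : ℝ, ∀ᶠ j in atTop, |g (d j)| ≤ M)
    (h1 : Tendsto (fun j => h (d j)) atTop (𝓝 c))
    (h2 : ∀ i, Tendsto (fun j => hi i (d j)) atTop (𝓝 (hi i z))) :
    ∃ x, h x = c ∧ ∀ i, hi i x = hi i z := by
  by_contra! hcon
  let a : X → ℕ → ℝ := fun x i => (1 / 2 : ℝ) ^ i * min 1 |hi i x - hi i z|
  have ha0 : ∀ x i, 0 ≤ a x i := fun x i => by positivity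
  have hale : ∀ x i, ‖a x i‖ ≤ (1 / 2 : ℝ) ^ i := by
    intro x i
    rw [Real.norm_of_nonneg (ha0 x i)]
    exact mul_le_of_le_one_right (by positivity) (min_le_left _ _)
  have hsum : Summable fun i : ℕ => (1 / 2 : ℝ) ^ i := summable_geometric_two
  have hsa : ∀ x, Summable (a x) := fun x => hsum.of_norm_bounded (hale x)
  let φ : X → ℝ := fun x => |h x - c| + ∑' i, a x i
  have hφc : Continuous φ := by
    refine Continuous.add (by fun_prop) ?_
    refine continuous_tsum (fun i => ?_) hsum (fun i x => hale x i)
    have := hhi i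
    fun_prop
  have hφpos : ∀ x, 0 < φ x := by
    intro x
    have hts : 0 ≤ ∑' i, a x i := tsum_nonneg (ha0 x)
    by_cases hx : h x = c
    · obtain ⟨i, hix⟩ := hcon x hx
      have : 0 < a x i := by
        have : 0 < |hi i x - hi i z| := abs_pos.2 (sub_ne_zero.2 hix)
        positivity
      have := (hsa x).le_tsum i (fun j _ => ha0 x j)
      have := abs_nonneg (h x - c)
      simp only [φ]; linarith
    · have := abs_pos.2 (sub_ne_zero.2 hx)
      simp only [φ]; linarith
  have hlim : Tendsto (fun j => φ (d j)) atTop (𝓝 0) := by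
    have e1 : Tendsto (fun j => |h (d j) - c|) atTop (𝓝 0) := by
      have := (h1.sub_const c).abs
      simpa using this
    have e2 : Tendsto (fun j => ∑' i, a (d j) i) atTop (𝓝 (∑' i : ℕ, (0 : ℝ))) := by
      refine tendsto_tsum_of_dominated_convergence hsum (fun i => ?_)
        (Eventually.of_forall fun j i => hale (d j) i)
      have e3 : Tendsto (fun j => |hi i (d j) - hi i z|) atTop (𝓝 0) := by
        have := ((h2 i).sub_const (hi i z)).abs
        simpa using this
      have e4 := ((tendsto_const_nhds (x := (1 : ℝ))).min e3).const_mul ((1 / 2 : ℝ) ^ i)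
      simpa [a] using e4
    simpa using e1.add e2
  obtain ⟨M, hM⟩ := hbd (fun x => (φ x)⁻¹) (hφc.inv₀ fun x => (hφpos x).ne')
  have hM1 : (0 : ℝ) < |M| + 1 := by positivity
  have hsmall : ∀ᶠ j in atTop, φ (d j) < (|M| + 1)⁻¹ :=
    hlim.eventually (gt_mem_nhds (by positivity))
  obtain ⟨j, hj1, hj2⟩ := (hM.and hsmall).exists
  rw [abs_of_pos (inv_pos.2 (hφpos _))] at hj1
  have : |M| + 1 < (φ (d j))⁻¹ := by
    rw [lt_inv_comm₀ hM1 (hφpos _)]; exact hj2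
  have := le_abs_self M
  linarith

lemma LL_cont {X : Type*} [TopologicalSpace X] {K : (ℕ → ℕ) → Set (X → ℝ)} (hK : CRes X K)
    (α : ℕ → ℕ) (f : X → ℝ) (hf : f ∈ LL K α) : Continuous f := by
  classical
  rcases isEmpty_or_nonempty X with hX | ⟨⟨z₀⟩⟩
  · exact continuous_of_const fun x => hX.elim x
  have hG : ∀ (F : Finset X) (n : ℕ), ∃ g ∈ CS K (res α n), ∀ x ∈ F,
      |g x - f x| < 1 / ((n : ℝ) + 1) := by
    intro F n
    have hfn : f ∈ closure (CS K (res α n)) := mem_iInter.1 hf n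
    have hopen : IsOpen (⋂ x ∈ F, {g : X → ℝ | |g x - f x| < 1 / ((n : ℝ) + 1)}) :=
      isOpen_biInter_finset fun x _ => isOpen_lt (by fun_prop) continuous_const
    obtain ⟨g, hg1, hg2⟩ := mem_closure_iff.1 hfn _ hopen (by
      simp only [mem_iInter, mem_ofPred_eq, sub_self, abs_zero]
      intro x _; positivity)
    exact ⟨g, hg2, by simpa using hg1⟩
  choose G hG1 hG2 using hG
  obtain ⟨D, hDc, hDn, hD⟩ := exists_closed K f z₀ G
  obtain ⟨e, rfl⟩ := hDc.exists_eq_range hDn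
  let F : ℕ → Finset X := fun j => (Finset.range j).image e
  have hF : ∀ j, (↑(F j) : Set X) ⊆ range e := by
    intro j x hx
    simp only [F, Finset.coe_image, mem_image] at hx
    obtain ⟨i, -, rfl⟩ := hx
    exact mem_range_self i
  let hs : ℕ → X → ℝ := fun j => G (F j) j
  obtain ⟨γ, hγ⟩ := seq_mem hK.1 α hs fun j => hG1 _ _
  obtain ⟨h, hhK, hh⟩ := (hK.2.1 γ).ultrafilter_le_nhds ((hyperfilter ℕ).map hs) (by
    rw [le_principal_iff]
    exact (Eventually.of_forall hγ : ∀ᶠ j in (hyperfilter ℕ : Filter ℕ), hs j ∈ K γ))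
  have hlim : ∀ x, Tendsto (fun j => hs j x) (hyperfilter ℕ) (𝓝 (h x)) :=
    fun x => (tendsto_pi_nhds.1 (show Tendsto hs (hyperfilter ℕ) (𝓝 h) from hh)) x
  have hfh : ∀ i, h (e i) = f (e i) := by
    intro i
    refine tendsto_nhds_unique (hlim (e i)) ?_
    refine Tendsto.mono_left ?_ Nat.hyperfilter_le_atTop
    rw [tendsto_iff_dist_tendsto_zero]
    refine squeeze_zero' (Eventually.of_forall fun _ => dist_nonneg) ?_
      tendsto_one_div_add_atTop_nhds_zero_nat
    filter_upwards [eventually_gt_atTop i] with j hj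
    rw [Real.dist_eq]
    exact (hG2 (F j) j (e i) (Finset.mem_image_of_mem e (Finset.mem_range.2 hj))).le
  have hhc : Continuous h := hK.2.2.1 γ h hhK
  suffices f = h by rw [this]; exact hhc
  funext z
  have : Nonempty ((Σ n : ℕ, (Fin n → ℕ)) × ℕ) := ⟨(res α 0, 0)⟩
  obtain ⟨en, hen⟩ := exists_surjective_nat ((Σ n : ℕ, (Fin n → ℕ)) × ℕ)
  let T : ℕ → Finset ((Σ n : ℕ, (Fin n → ℕ)) × ℕ) := fun j =>
    ((Finset.range j).image en).filter fun t => ∀ g ∈ CS K t.1, |g z| ≤ (t.2 : ℝ)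
  have hzT : ∀ j, z ∈ NN K (T j) := fun j t ht => (Finset.mem_filter.1 ht).2
  have hd : ∀ j : ℕ, ∃ d, d ∈ range e ∧ d ∈ NN K (T j) ∧ |f d - f z| < 1 / ((j : ℝ) + 1) ∧
      ∀ i < j, |hs i d - hs i z| < 1 / ((j : ℝ) + 1) := by
    intro j
    obtain ⟨d, a1, a2, a3, a4⟩ := hD (T j) z (hzT j)
      ((Finset.range j).image fun i => (F i, i)) (by
        intro q hq
        obtain ⟨i, -, rfl⟩ := Finset.mem_image.1 hq
        exact hF i) (1 / ((j : ℝ) + 1)) (by positivity)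
    refine ⟨d, a1, a2, a3, fun i hi => ?_⟩
    exact a4 (F i, i) (Finset.mem_image_of_mem (fun i => (F i, i)) (Finset.mem_range.2 hi))
  choose d d1 d2 d3 d4 using hd
  obtain ⟨x, hx1, hx2⟩ := pin h hs hhc (fun i => hK.2.2.1 γ _ (hγ i)) z (f z) d (by
      intro g hg
      obtain ⟨β, hβ⟩ := hK.2.2.2 g hg
      obtain ⟨n, hn⟩ := bdd hK β z
      obtain ⟨j₀, hj₀⟩ := hen (res β n, n)
      refine ⟨n, ?_⟩
      filter_upwards [eventually_gt_atTop j₀] with j hj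
      refine d2 j (res β n, n) ?_ g (mem_CS_res.2 ⟨β, fun _ _ => rfl, hβ⟩)
      refine Finset.mem_filter.2 ⟨?_, hn⟩
      rw [← hj₀]
      exact Finset.mem_image_of_mem en (Finset.mem_range.2 hj)) (by
      have : ∀ j, h (d j) = f (d j) := by
        intro j
        obtain ⟨i, hi⟩ := d1 j
        rw [← hi]; exact hfh i
      simp only [this]
      rw [tendsto_iff_dist_tendsto_zero]
      exact squeeze_zero (fun _ => dist_nonneg) (fun j => by rw [Real.dist_eq]; exact (d3 j).le)
        tendsto_one_div_add_atTop_nhds_zero_nat) (by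
      intro i
      rw [tendsto_iff_dist_tendsto_zero]
      refine squeeze_zero' (Eventually.of_forall fun _ => dist_nonneg) ?_
        tendsto_one_div_add_atTop_nhds_zero_nat
      filter_upwards [eventually_gt_atTop i] with j hj
      rw [Real.dist_eq]; exact (d4 j i hj).le)
  rw [← hx1]
  refine tendsto_nhds_unique (hlim x) ?_
  simp only [hx2]
  exact hlim z

lemma kAnalytic {X : Type*} [TopologicalSpace X] {K : (ℕ → ℕ) → Set (X → ℝ)} (hK : CRes X K) :
    KAnalyticSpace {f : X → ℝ // Continuous f} := by
  refine ⟨fun α => {f | f.1 ∈ LL K α}, fun α => ?_, ?_, ?_⟩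
  · rw [Subtype.isCompact_iff]
    have : Subtype.val '' {f : {f : X → ℝ // Continuous f} | f.1 ∈ LL K α} = LL K α := by
      ext f
      constructor
      · rintro ⟨g, hg, rfl⟩; exact hg
      · intro hf; exact ⟨⟨f, LL_cont hK α f hf⟩, hf, rfl⟩
    rw [this]
    exact LL_compact hK α
  · refine eq_univ_of_forall fun f => ?_
    obtain ⟨α, hα⟩ := hK.2.2.2 f.1 f.2
    exact mem_iUnion.2 ⟨α, mem_iInter.2 fun n =>
      subset_closure (mem_CS_res.2 ⟨α, fun _ _ => rfl, hα⟩)⟩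
  · intro U hU
    obtain ⟨V, hV, rfl⟩ := isOpen_induced_iff.1 hU
    convert isOpen_LL hK V hV using 1
    ext α
    constructor
    · intro h f hf
      exact h (show (⟨f, LL_cont hK α f hf⟩ : {f : X → ℝ // Continuous f}) ∈ _ from hf)
    · intro h f hf
      exact h hf

lemma lindelof {Z : Type*} [TopologicalSpace Z] (hZ : KAnalyticSpace Z) {ι : Type*}
    (O : ι → Set Z) (hO : ∀ i, IsOpen (O i)) (hc : ∀ z, ∃ i, z ∈ O i) :
    ∃ T : Set ι, T.Countable ∧ ∀ z, ∃ i ∈ T, z ∈ O i := by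
  obtain ⟨K, hK, hcov, husc⟩ := hZ
  have h1 : ∀ α, ∃ t : Finset ι, K α ⊆ ⋃ i ∈ t, O i := fun α =>
    (hK α).elim_finite_subcover O hO fun z _ => mem_iUnion.2 (hc z)
  choose t ht using h1
  obtain ⟨S, hS, hSu⟩ := TopologicalSpace.isOpen_iUnion_countable
    (fun α => {β | K β ⊆ ⋃ i ∈ t α, O i})
    (fun α => husc _ (isOpen_biUnion fun i _ => hO i))
  refine ⟨⋃ α ∈ S, ↑(t α), hS.biUnion fun α _ => (t α).countable_toSet, fun z => ?_⟩
  obtain ⟨β, hβ⟩ := mem_iUnion.1 (hcov.symm ▸ mem_univ z : z ∈ ⋃ α, K α)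
  have : β ∈ ⋃ α, {β | K β ⊆ ⋃ i ∈ t α, O i} := mem_iUnion.2 ⟨β, ht β⟩
  rw [← hSu] at this
  simp only [mem_iUnion] at this
  obtain ⟨α, hα, hβα⟩ := this
  have := hβα hβ
  simp only [mem_iUnion] at this
  obtain ⟨i, hi, hzi⟩ := this
  refine ⟨i, ?_, hzi⟩
  simp only [mem_iUnion]
  exact ⟨α, hα, hi⟩

lemma prodRes {X : Type*} [TopologicalSpace X] {K : (ℕ → ℕ) → Set (X → ℝ)} (hK : CRes X K)
    (n : ℕ) : CRes (X × Fin n)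
      (fun α => (fun (G : Fin n → X → ℝ) (p : X × Fin n) => G p.2 p.1) ''
        (Set.pi univ fun _ => K α)) := by
  refine ⟨fun α β h => image_mono (Set.pi_mono fun _ _ => hK.1 h), fun α => ?_, ?_, ?_⟩
  · refine (isCompact_univ_pi fun _ => hK.2.1 α).image ?_
    fun_prop
  · rintro α _ ⟨G, hG, rfl⟩
    rw [continuous_prod_of_discrete_right]
    intro i
    exact hK.2.2.1 α _ (hG i (mem_univ _))
  · intro f hf
    have : ∀ i : Fin n, ∃ α, (fun x => f (x, i)) ∈ K α := fun i =>
      hK.2.2.2 _ (by fun_prop)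
    choose α hα using this
    refine ⟨fun k => ∑ i, α i k, fun i x => f (x, i), fun i _ => ?_, rfl⟩
    refine hK.1 (fun k => ?_) (hα i)
    exact Finset.single_le_sum (f := fun i => α i k) (fun _ _ => Nat.zero_le _)
      (Finset.mem_univ i)

lemma tight {X : Type*} [TopologicalSpace X] [CompletelyRegularSpace X]
    {K : (ℕ → ℕ) → Set (X → ℝ)} (hK : CRes X K) (n : ℕ) :
    CountablyTightSpace (Fin n → X) := by
  intro A y hy
  obtain ⟨T, hT, hTc⟩ := lindelof (kAnalytic (prodRes hK n))
    (fun a : A => {f | ∀ i, |f.1 (a.1 i, i) - f.1 (y i, i)| < 1})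
    (fun a => by
      have : {f : {f : X × Fin n → ℝ // Continuous f} |
          ∀ i, |f.1 (a.1 i, i) - f.1 (y i, i)| < 1} =
          ⋂ i, {f | |f.1 (a.1 i, i) - f.1 (y i, i)| < 1} := by ext; simp
      rw [this]
      refine isOpen_iInter_of_finite fun i => ?_
      have h1 : ∀ p : X × Fin n, Continuous
          fun f : {f : X × Fin n → ℝ // Continuous f} => f.1 p :=
        fun p => (continuous_apply p).comp continuous_subtype_val
      exact isOpen_lt ((h1 _).sub (h1 _)).abs continuous_const)
    (fun f => by
      have hf := f.2
      have hopen : IsOpen (⋂ i, {a : Fin n → X | |f.1 (a i, i) - f.1 (y i, i)| < 1}) :=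
        isOpen_iInter_of_finite fun i => isOpen_lt (by fun_prop) continuous_const
      obtain ⟨a, h1, h2⟩ := mem_closure_iff.1 hy _ hopen (by simp)
      exact ⟨⟨a, h2⟩, by simpa using h1⟩)
  refine ⟨Subtype.val '' T, by rintro _ ⟨a, -, rfl⟩; exact a.2, hT.image _, ?_⟩
  rw [mem_closure_iff_nhds]
  intro W hW
  rw [nhds_pi, Filter.mem_pi] at hW
  obtain ⟨I, -, V, hV, hVW⟩ := hW
  have : ∀ i, ∃ g : X → ℝ, Continuous g ∧ g (y i) = 0 ∧ ∀ x, g x < 1 → x ∈ V i := by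
    intro i
    obtain ⟨O, hOV, hO, hyO⟩ := mem_nhds_iff.1 (hV i)
    obtain ⟨g, hg, hg0, hg1⟩ := CompletelyRegularSpace.completely_regular (y i) Oᶜ
      hO.isClosed_compl (by simpa using hyO)
    refine ⟨fun x => (g x : ℝ), by fun_prop, by simp [hg0], fun x hx => ?_⟩
    by_contra hxV
    have := hg1 (show x ∈ Oᶜ from fun h => hxV (hOV h))
    simp [this] at hx
  choose g hg hg0 hg1 using this
  obtain ⟨a, haT, ha⟩ := hTc ⟨fun p => g p.2 p.1, by
    rw [continuous_prod_of_discrete_right]; exact hg⟩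
  refine ⟨a.1, hVW fun i _ => hg1 i _ ?_, a, haT, rfl⟩
  have := ha i
  simp only [hg0, sub_zero] at this
  exact (le_abs_self _).trans_lt this

lemma exists_res {X : Type*} [t : TopologicalSpace X]
    (hfine : ∃ u : UniformSpace X, u.toTopologicalSpace = t ∧
      (∀ d : X → X → ℝ, (∀ x, d x x = 0) → (∀ x y, d x y = d y x) →
        (∀ x y z, d x z ≤ d x y + d y z) →
        Continuous (fun p : X × X => d p.1 p.2) →
        ∀ ε : ℝ, 0 < ε → {p : X × X | d p.1 p.2 < ε} ∈ @uniformity X u) ∧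
      ∃ U : (ℕ → ℕ) → Set (X × X), (∀ α, U α ∈ @uniformity X u) ∧
        (∀ V ∈ @uniformity X u, ∃ α, U α ⊆ V) ∧
        ∀ α β : ℕ → ℕ, α ≤ β → U β ⊆ U α)
    (hdom : ∃ φ : (ℕ → ℕ) → (X → ℝ), Monotone φ ∧
      ∀ f : X → ℝ, Continuous f → ∃ α : ℕ → ℕ, f ≤ φ α) :
    ∃ K, CRes X K := by
  obtain ⟨u, rfl, hps, U, hU, hUb, hUm⟩ := hfine
  obtain ⟨φ, hφ, hφd⟩ := hdom
  let dec : (ℕ → ℕ) → ℕ → ℕ → ℕ := fun α k m => α (Nat.pair k m)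
  have hdec : ∀ α β, α ≤ β → ∀ k, dec α k ≤ dec β k := fun α β h k m => h _
  refine ⟨fun α => {f | (∀ x, |f x| ≤ φ (dec α 0) x) ∧
    ∀ k : ℕ, ∀ p ∈ U (dec α (k + 1)), |f p.1 - f p.2| ≤ 1 / ((k : ℝ) + 1)}, ?_, ?_, ?_, ?_⟩
  · intro α β h f hf
    exact ⟨fun x => (hf.1 x).trans (hφ (hdec α β h 0) x),
      fun k p hp => hf.2 k p (hUm _ _ (hdec α β h (k + 1)) hp)⟩
  · intro α
    have hc : IsCompact (Set.pi univ fun x : X => Icc (-(φ (dec α 0) x)) (φ (dec α 0) x)) :=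
      isCompact_univ_pi fun x => isCompact_Icc
    refine hc.of_isClosed_subset ?_ fun f hf x _ => abs_le.1 (hf.1 x)
    simp only [ofPred_and, ofPred_forall]
    refine IsClosed.inter (isClosed_iInter fun x => isClosed_le (by fun_prop) continuous_const) ?_
    exact isClosed_iInter fun k => isClosed_iInter fun p => isClosed_iInter fun _ =>
      isClosed_le (by fun_prop) continuous_const
  · intro α f hf
    refine UniformContinuous.continuous ?_
    refine Metric.uniformity_basis_dist.tendsto_right_iff.2 fun ε hε => ?_
    obtain ⟨k, hk⟩ := exists_nat_one_div_lt hε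
    filter_upwards [hU (dec α (k + 1))] with p hp
    rw [Real.dist_eq]
    exact (hf.2 k p hp).trans_lt hk
  · intro f hf
    obtain ⟨a, ha⟩ := hφd (fun x => |f x|) hf.abs
    have : ∀ k : ℕ, ∃ b, U b ⊆ {p : X × X | |f p.1 - f p.2| < 1 / ((k : ℝ) + 1)} := by
      intro k
      refine hUb _ (hps (fun x y => |f x - f y|) (by simp) (fun x y => abs_sub_comm _ _)
        (fun x y z => abs_sub_le _ _ _) (by fun_prop) _ (by positivity))
    choose b hb using this
    let c : ℕ → ℕ → ℕ := fun k => match k with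
      | 0 => a
      | k + 1 => b k
    refine ⟨fun m => c (Nat.unpair m).1 (Nat.unpair m).2, ?_, ?_⟩
    · intro x
      simpa [dec, c] using ha x
    · intro k p hp
      have : p ∈ U (b k) := by simpa [dec, c] using hp
      exact (hb k this).le

end GBaseAux

/-- Let `X` be a completely regular Hausdorff space whose finest compatible uniformity
has a `𝔊`-base, and suppose `C(X)` is `ω^ω`-dominated in `ℝ^X`. Then the function space
`C_p(X)` is K-analytic and every finite power of `X` is countably tight. -/
theorem kAnalytic_Cp_and_countablyTight_of_gBase_dominated
    {X : Type*} [t : TopologicalSpace X] [CompletelyRegularSpace X] [T2Space X]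
    (hfine : ∃ u : UniformSpace X, u.toTopologicalSpace = t ∧
      (∀ d : X → X → ℝ, (∀ x, d x x = 0) → (∀ x y, d x y = d y x) →
        (∀ x y z, d x z ≤ d x y + d y z) →
        Continuous (fun p : X × X => d p.1 p.2) →
        ∀ ε : ℝ, 0 < ε → {p : X × X | d p.1 p.2 < ε} ∈ @uniformity X u) ∧
      ∃ U : (ℕ → ℕ) → Set (X × X), (∀ α, U α ∈ @uniformity X u) ∧
        (∀ V ∈ @uniformity X u, ∃ α, U α ⊆ V) ∧
        ∀ α β : ℕ → ℕ, α ≤ β → U β ⊆ U α)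
    (hdom : ∃ φ : (ℕ → ℕ) → (X → ℝ), Monotone φ ∧
      ∀ f : X → ℝ, Continuous f → ∃ α : ℕ → ℕ, f ≤ φ α) :
    KAnalyticSpace {f : X → ℝ // Continuous f} ∧
    ∀ n : ℕ, CountablyTightSpace (Fin n → X) := by
  obtain ⟨K, hK⟩ := GBaseAux.exists_res hfine hdom
  exact ⟨GBaseAux.kAnalytic hK, fun n => GBaseAux.tight hK n⟩
end

section
/- Let X be a separable completely regular Hausdorff space whose finest compatible uniformity has a 𝔊-base, i.e., there is a uniformity 𝒰 on X inducing the topology of X such that every continuous pseudometric on X is uniformly continuous with respect to 𝒰 and 𝒰 has a 𝔊-base. Then the function space C_p(X) is analytic, and X is cosmic and σ-compact; in particular, X is a countable union of compact metrizable subspaces. -/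
open Set Filter Topology Uniformity

/-- A topological space is analytic if it is a continuous image of a Polish space. -/
def AnalyticSpace (Y : Type*) [TopologicalSpace Y] : Prop :=
  ∃ (P : Type) (_ : TopologicalSpace P), PolishSpace P ∧
    ∃ g : P → Y, Continuous g ∧ Function.Surjective g

/-- A topological space is cosmic if it has a countable network. -/
def Cosmic (Y : Type*) [TopologicalSpace Y] : Prop :=
  ∃ N : Set (Set Y), N.Countable ∧
    ∀ y : Y, ∀ U : Set Y, IsOpen U → y ∈ U → ∃ s ∈ N, y ∈ s ∧ s ⊆ U

/-- Cosmic spaces are hereditarily Lindelof. -/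
lemma Cosmic.cover {X : Type*} [TopologicalSpace X] (hX : Cosmic X) (S : Set X)
    (G : X → Set X) (hG : ∀ x ∈ S, G x ∈ 𝓝 x) :
    ∃ T ⊆ S, T.Countable ∧ S ⊆ ⋃ x ∈ T, G x := by
  classical
  rcases isEmpty_or_nonempty X with hE | hE
  · exact ⟨∅, empty_subset _, countable_empty, fun x => (hE.false x).elim⟩
  obtain ⟨N, hN, hnet⟩ := hX
  let good : Set (Set X) := {n ∈ N | ∃ x ∈ S, n ⊆ G x}
  have hgood : good.Countable := hN.mono fun n hn => hn.1
  choose! c hcS hc using fun (n : Set X) (hn : n ∈ good) => hn.2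
  refine ⟨c '' good, ?_, hgood.image c, ?_⟩
  · rintro _ ⟨n, hn, rfl⟩
    exact hcS n hn
  · intro x hx
    obtain ⟨n, hnN, hxn, hnG⟩ := hnet x (interior (G x)) isOpen_interior
      (mem_interior_iff_mem_nhds.2 (hG x hx))
    have hn : n ∈ good := ⟨hnN, x, hx, hnG.trans interior_subset⟩
    exact mem_biUnion (mem_image_of_mem c hn) (hc n hn hxn)

/-- A pseudometric from a point-finite partition of unity. -/
lemma partition_pseudometric {X : Type*} [UniformSpace X]
    (hfine : ∀ d : X → X → ℝ, (∀ x, d x x = 0) → (∀ x y, d x y = d y x) →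
        (∀ x y z, d x z ≤ d x y + d y z) →
        Continuous (fun p : X × X => d p.1 p.2) →
        ∀ ε : ℝ, 0 < ε → {p : X × X | d p.1 p.2 < ε} ∈ 𝓤 X)
    (p : ℕ → X → ℝ) (hc : ∀ k, Continuous (p k))
    (hlf : LocallyFinite fun k => Function.support (p k))
    (h0 : ∀ k x, 0 ≤ p k x) (h1 : ∀ x, ∑ᶠ k, p k x = 1) :
    {q : X × X | ∃ k, p k q.1 ≠ 0 ∧ p k q.2 ≠ 0} ∈ 𝓤 X := by
  have hfin : ∀ x, (Function.support fun k => p k x).Finite := fun x => hlf.point_finite x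
  have hfin2 : ∀ x y, (Function.support fun k => |p k x - p k y|).Finite := by
    intro x y
    refine ((hfin x).union (hfin y)).subset fun k hk => ?_
    by_contra hcon
    simp only [mem_union, Function.mem_support, not_or, not_not] at hcon
    exact hk (by simp [hcon.1, hcon.2])
  have key := hfine (fun x y => ∑ᶠ k, |p k x - p k y|) (by simp)
    (fun x y => finsum_congr fun k => abs_sub_comm _ _)
    (fun x y z => by
      rw [← finsum_add_distrib (hfin2 x y) (hfin2 y z)]
      refine finsum_le_finsum' (hfin2 x z)
        (((hfin2 x y).union (hfin2 y z)).subset (Function.support_add _ _)) fun k => ?_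
      exact abs_sub_le _ _ _)
    (by
      refine continuous_finsum (fun k => ?_) ?_
      · exact (((hc k).comp continuous_fst).sub ((hc k).comp continuous_snd)).abs
      · intro q
        obtain ⟨t, ht, htf⟩ := hlf q.1
        obtain ⟨t', ht', htf'⟩ := hlf q.2
        refine ⟨t ×ˢ t', prod_mem_nhds ht ht', (htf.union htf').subset ?_⟩
        rintro k ⟨r, hr, hrt⟩
        by_contra hcon
        simp only [mem_union, mem_ofPred_eq, not_or] at hcon
        have e1 : p k r.1 = 0 := by
          by_contra h
          exact hcon.1 ⟨r.1, h, hrt.1⟩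
        have e2 : p k r.2 = 0 := by
          by_contra h
          exact hcon.2 ⟨r.2, h, hrt.2⟩
        exact hr (by simp [e1, e2]))
    2 two_pos
  refine mem_of_superset key ?_
  rintro ⟨x, y⟩ hxy
  by_contra hcon
  simp only [mem_ofPred_eq, not_exists, not_and_or, not_not] at hcon
  have : ∑ᶠ k, |p k x - p k y| = 2 := by
    rw [finsum_congr (g := fun k => p k x + p k y), finsum_add_distrib (hfin x) (hfin y), h1, h1]
    · norm_num
    · intro k
      rcases hcon k with h | h
      · simp [h, abs_of_nonneg (h0 k y)]
      · simp [h, abs_of_nonneg (h0 k x)]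
  simp only [mem_ofPred_eq, this, lt_irrefl] at hxy

/-- In the fine uniformity of a cosmic space, all neighborhoods of the diagonal are entourages. -/
lemma diag_nhds_mem_uniformity {X : Type*} [UniformSpace X] [Nonempty X]
    (hX : Cosmic X)
    (hfine : ∀ d : X → X → ℝ, (∀ x, d x x = 0) → (∀ x y, d x y = d y x) →
        (∀ x y z, d x z ≤ d x y + d y z) →
        Continuous (fun p : X × X => d p.1 p.2) →
        ∀ ε : ℝ, 0 < ε → {p : X × X | d p.1 p.2 < ε} ∈ 𝓤 X)
    (W : Set (X × X)) (hW : ∀ x, ∃ N ∈ 𝓝 x, N ×ˢ N ⊆ W) : W ∈ 𝓤 X := by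
  choose N hN hNW using hW
  have hex : ∀ x, ∃ f : X → ℝ, Continuous f ∧ 0 < f x ∧ ∀ y, 0 < f y → y ∈ N x := by
    intro x
    obtain ⟨f, hf, hfx, hf1⟩ := CompletelyRegularSpace.completely_regular x (interior (N x))ᶜ
      isOpen_interior.isClosed_compl (by simpa using mem_interior_iff_mem_nhds.2 (hN x))
    refine ⟨fun y => 1 - (f y : ℝ), by fun_prop, by simp [hfx], fun y hy => ?_⟩
    by_contra hcon
    have : f y = 1 := hf1 (fun h => hcon (interior_subset h))
    simp [this] at hy
  choose f hf hfx hfN using hex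
  obtain ⟨T, -, hTc, hT⟩ := hX.cover univ (fun x => {y | 0 < f x y})
    (fun x _ => (isOpen_lt continuous_const (hf x)).mem_nhds (hfx x))
  have hTne : T.Nonempty := by
    obtain ⟨x⟩ := ‹Nonempty X›
    obtain ⟨y, hy, -⟩ := mem_iUnion₂.1 (hT (mem_univ x))
    exact ⟨y, hy⟩
  obtain ⟨e, he⟩ := hTc.exists_eq_range hTne
  have hpos : ∀ y, ∃ k, 0 < f (e k) y := by
    intro y
    obtain ⟨z, hz, hzy⟩ := mem_iUnion₂.1 (hT (mem_univ y))
    rw [he] at hz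
    obtain ⟨k, rfl⟩ := hz
    exact ⟨k, hzy⟩
  let M := {m : ℕ → ℝ // ∃ k, 0 < m k}
  have hMm : TopologicalSpace.MetrizableSpace M :=
    Topology.IsEmbedding.subtypeVal.metrizableSpace
  let _ : MetricSpace M := TopologicalSpace.metrizableSpaceMetric M
  let Φ : X → M := fun y => ⟨fun k => f (e k) y, hpos y⟩
  have hΦ : Continuous Φ := Continuous.subtype_mk (continuous_pi fun k => hf (e k)) _
  obtain ⟨ρ, hρ⟩ := PartitionOfUnity.exists_isSubordinate (X := M) isClosed_univ
    (fun k : ℕ => {m : M | 0 < m.1 k})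
    (fun k => isOpen_lt continuous_const ((continuous_apply k).comp continuous_subtype_val))
    (fun m _ => mem_iUnion.2 m.2)
  have := partition_pseudometric hfine (fun k x => ρ k (Φ x)) (fun k => (ρ k).continuous.comp hΦ)
    (ρ.locallyFinite.preimage_continuous hΦ) (fun k x => ρ.nonneg k _)
    (fun x => ρ.sum_eq_one (mem_univ _))
  refine mem_of_superset this ?_
  rintro ⟨x, y⟩ ⟨k, hx, hy⟩
  have hxpos : 0 < f (e k) x := hρ k (subset_tsupport _ hx)
  have hypos : 0 < f (e k) y := hρ k (subset_tsupport _ hy)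
  exact hNW (e k) ⟨hfN _ _ hxpos, hfN _ _ hypos⟩

/-- The basic neighborhoods of the Baire space. -/
def Cyl (s : List ℕ) : Set (ℕ → ℕ) := {α | ∀ i < s.length, α i = s.getD i 0}

/-- `A` is captured by `s`. -/
def Capt {X : Type*} [UniformSpace X] (U : (ℕ → ℕ) → Set (X × X)) (s : List ℕ) (A : Set X) :
    Prop := ∀ V ∈ 𝓤 X, ∃ α ∈ Cyl s, ∀ x ∈ A, ∀ y ∈ A, (x, y) ∈ U α → (x, y) ∈ V

lemma Capt.mono {X : Type*} [UniformSpace X] {U : (ℕ → ℕ) → Set (X × X)} {s : List ℕ}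
    {A B : Set X} (hA : Capt U s A) (h : B ⊆ A) : Capt U s B := by
  intro V hV
  obtain ⟨α, hα, H⟩ := hA V hV
  exact ⟨α, hα, fun x hx y hy => H x (h hx) y (h hy)⟩

lemma mem_cyl_append {s : List ℕ} {α : ℕ → ℕ} (h : α ∈ Cyl s) :
    α ∈ Cyl (s ++ [α s.length]) := by
  intro i hi
  simp only [List.length_append, List.length_singleton] at hi
  rcases Nat.lt_succ_iff_lt_or_eq.1 hi with h' | rfl
  · rw [h i h', List.getD_append _ _ _ _ h']
  · simp [List.getD]

lemma capt_seq {X : Type*} [UniformSpace X]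
    {U : (ℕ → ℕ) → Set (X × X)}
    (hdiag : ∀ W : Set (X × X), (∀ x, ∃ N ∈ 𝓝 x, N ×ˢ N ⊆ W) → W ∈ 𝓤 X)
    {s : List ℕ} {O : Set X} (hO : Capt U s O) (A : ℕ → Set X) (hAO : ∀ i, A i ⊆ O)
    (hA : Antitone A) (hemp : ∀ x, ∃ i, x ∉ closure (A i)) :
    ∃ i, Capt U (s ++ [i]) (A i) := by
  by_contra! hcon
  simp only [Capt, not_forall] at hcon
  choose V hV hcon using hcon
  push Not at hcon
  obtain ⟨α, hα, H⟩ := hO {q | ∀ i, q.1 ∈ A i → q.2 ∈ A i → q ∈ V i} (by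
    refine hdiag _ fun x => ?_
    obtain ⟨n, hn⟩ := hemp x
    have hV' : ∀ i, ∃ N ∈ 𝓝 x, N ×ˢ N ⊆ V i := fun i => by
      obtain ⟨a, ha, b, hb, hab⟩ := mem_nhds_prod_iff.1 (nhds_le_uniformity x (hV i))
      exact ⟨a ∩ b, inter_mem ha hb,
        (prod_mono inter_subset_left inter_subset_right).trans hab⟩
    choose N hN hNV using hV'
    refine ⟨(closure (A n))ᶜ ∩ ⋂ i ∈ Finset.range n, N i,
      inter_mem (isClosed_closure.isOpen_compl.mem_nhds hn)
        ((biInter_finset_mem _).2 fun i _ => hN i), ?_⟩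
    rintro ⟨y, z⟩ ⟨⟨hy, hy'⟩, hz, hz'⟩ i hyi hzi
    have hin : i < n := by
      by_contra! h
      exact hy (subset_closure (hA h hyi))
    simp only [mem_iInter, Finset.mem_range] at hy' hz'
    exact hNV i ⟨hy' i hin, hz' i hin⟩)
  obtain ⟨x, hx, y, hy, hxy, hn⟩ := hcon (α s.length) α (mem_cyl_append hα)
  exact hn (H x (hAO _ hx) y (hAO _ hy) hxy _ hx hy)

/-- Suprema of eventually coherent sequences. -/
lemma exists_sup (α : ℕ → ℕ) (n : ℕ) (β : ℕ → ℕ → ℕ)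
    (h : ∀ m, ∀ i < n + m, β m i = α i) : ∃ γ : ℕ → ℕ, (∀ m, β m ≤ γ) ∧ ∀ i < n, γ i = α i := by
  refine ⟨fun i => α i ⊔ (Finset.range (i + 1)).sup fun m => β m i, fun m i => ?_, fun i hi => ?_⟩
  · by_cases hm : m < i + 1
    · exact le_sup_of_le_right
        (Finset.le_sup (f := fun m => β m i) (Finset.mem_range.2 hm))
    · exact le_sup_of_le_left (h m i (by omega)).le
  · refine sup_eq_left.2 (Finset.sup_le fun m _ => (h m i (by omega)).le)

/-- Points with coherent captured neighborhoods are isolated. -/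
lemma isolated_of_branch {X : Type*} [UniformSpace X]
    {U : (ℕ → ℕ) → Set (X × X)} (hU : ∀ α, U α ∈ 𝓤 X)
    (hmono : ∀ α β : ℕ → ℕ, α ≤ β → U β ⊆ U α)
    (x : X) (G : ℕ → Set X) (hG : ∀ n, G n ∈ 𝓝 x) (hGx : ⋂ n, G n ⊆ {x})
    (α : ℕ → ℕ) (A : ℕ → Set X) (hA : ∀ n, A n ∈ 𝓝 x)
    (hc : ∀ n, Capt U ((List.range n).map α) (A n)) : {x} ∈ 𝓝 x := by
  let B : ℕ → Set X := fun n => ⋂ i ∈ Finset.range (n + 1), A i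
  have hB : ∀ n, B n ∈ 𝓝 x := fun n => (biInter_finset_mem _).2 fun i _ => hA i
  have hBA : ∀ n, B n ⊆ A n := fun n => biInter_subset_of_mem (by simp)
  have hV : ∀ n, ∃ V ∈ 𝓤 X, ∀ y, (x, y) ∈ V → y ∈ B (n + 1) ∩ G n := by
    intro n
    obtain ⟨V, hV, h⟩ := UniformSpace.mem_nhds_iff.1 (inter_mem (hB (n + 1)) (hG n))
    exact ⟨V, hV, fun y hy => h hy⟩
  choose V hV hVB using hV
  choose β hβ H using fun n => ((hc n).mono (hBA n)) (V n) (hV n)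
  obtain ⟨γ, hγ, -⟩ := exists_sup α 0 β (by
    intro m i hi
    rw [zero_add] at hi
    have := hβ m i (by simpa using hi)
    simpa [List.getD, hi] using this)
  have hnb : {y | (x, y) ∈ U γ} ∩ B 0 ∈ 𝓝 x := inter_mem (UniformSpace.ball_mem_nhds x (hU γ)) (hB 0)
  refine mem_of_superset hnb ?_
  rintro y ⟨hy, hy0⟩
  have hyB : ∀ n, y ∈ B n := by
    intro n
    induction n with
    | zero => exact hy0
    | succ n ih =>
      exact (hVB n y (H n x (mem_of_mem_nhds (hB n)) y ih (hmono _ _ (hγ n) hy))).1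
  exact hGx (mem_iInter.2 fun n =>
    (hVB n y (H n x (mem_of_mem_nhds (hB n)) y (hyB n) (hmono _ _ (hγ n) hy))).2)

/-- The compact pieces. -/
lemma compact_piece {X : Type*} [UniformSpace X] (hX : Cosmic X)
    {U : (ℕ → ℕ) → Set (X × X)}
    (hdiag : ∀ W : Set (X × X), (∀ x, ∃ N ∈ 𝓝 x, N ×ˢ N ⊆ W) → W ∈ 𝓤 X)
    {s : List ℕ} {O C : Set X} (hOo : IsOpen O) (hO : Capt U s O) (hCO : C ⊆ O)
    (hC : IsClosed C) (hCE : ∀ x ∈ C, ∀ i, ∀ A ∈ 𝓝 x, ¬ Capt U (s ++ [i]) A) : IsCompact C := by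
  refine isCompact_of_finite_subcover fun {ι} W hWo hCW => ?_
  have hex : ∀ x, ∃ G ∈ 𝓝 x, ∃ t : Finset ι, C ∩ closure G ⊆ ⋃ i ∈ t, W i := by
    intro x
    by_cases hx : x ∈ C
    · obtain ⟨i, hi⟩ := mem_iUnion.1 (hCW hx)
      obtain ⟨G, hG, hGc, hGW⟩ := exists_mem_nhds_isClosed_subset ((hWo i).mem_nhds hi)
      refine ⟨G, hG, {i}, fun y hy => ?_⟩
      rw [hGc.closure_eq] at hy
      simpa using hGW hy.2
    · obtain ⟨G, hG, hGc, hGW⟩ := exists_mem_nhds_isClosed_subset (hC.isOpen_compl.mem_nhds hx)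
      refine ⟨G, hG, ∅, fun y hy => ?_⟩
      rw [hGc.closure_eq] at hy
      exact absurd hy.1 (hGW hy.2)
  choose G hG t ht using hex
  obtain ⟨T, -, hTc, hT⟩ := hX.cover univ (fun x => interior (G x))
    (fun x _ => interior_mem_nhds.2 (hG x))
  rcases C.eq_empty_or_nonempty with rfl | ⟨x0, -⟩
  · exact ⟨∅, by simp⟩
  have hTne : T.Nonempty := by
    obtain ⟨y, hy, -⟩ := mem_iUnion₂.1 (hT (mem_univ x0))
    exact ⟨y, hy⟩
  obtain ⟨e, he⟩ := hTc.exists_eq_range hTne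
  let A : ℕ → Set X := fun i => O ∩ ⋂ j ∈ Finset.range i, (closure (G (e j)))ᶜ
  have hAo : ∀ i, IsOpen (A i) := fun i =>
    hOo.inter (isOpen_biInter_finset fun j _ => isClosed_closure.isOpen_compl)
  obtain ⟨i, hi⟩ := capt_seq hdiag hO A (fun i => inter_subset_left) (by
      intro i j hij
      refine inter_subset_inter_right _ (biInter_subset_biInter_left fun k hk => ?_)
      simp only [Finset.mem_coe, Finset.mem_range] at hk ⊢
      exact lt_of_lt_of_le hk hij) (by
      intro x
      obtain ⟨y, hy, hyx⟩ := mem_iUnion₂.1 (hT (mem_univ x))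
      rw [he] at hy
      obtain ⟨j, rfl⟩ := hy
      refine ⟨j + 1, fun hcl => ?_⟩
      obtain ⟨z, hz, hzA⟩ := mem_closure_iff.1 hcl _ isOpen_interior hyx
      have h2 := mem_iInter₂.1 hzA.2 j (Finset.self_mem_range_succ j)
      exact h2 (subset_closure (interior_subset hz)))
  classical
  refine ⟨(Finset.range i).biUnion fun j => t (e j), fun x hx => ?_⟩
  have hxA : x ∉ A i := fun h => hCE x hx i (A i) ((hAo i).mem_nhds h) hi
  simp only [A, mem_inter_iff, hCO hx, true_and, mem_iInter, not_forall, mem_compl_iff,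
    not_not] at hxA
  obtain ⟨j, hj, hxj⟩ := hxA
  obtain ⟨k, hk, hxk⟩ := mem_iUnion₂.1 (ht (e j) ⟨hx, hxj⟩)
  exact mem_biUnion (Finset.mem_coe.2 (Finset.mem_biUnion.2 ⟨j, hj, hk⟩)) hxk

/-- A cosmic space with a fine uniformity having a monotone base is sigma-compact. -/
lemma countable_compact_cover {X : Type*} [UniformSpace X] (hX : Cosmic X)
    {U : (ℕ → ℕ) → Set (X × X)} (hU : ∀ α, U α ∈ 𝓤 X)
    (hbase : ∀ V ∈ 𝓤 X, ∃ α, U α ⊆ V)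
    (hmono : ∀ α β : ℕ → ℕ, α ≤ β → U β ⊆ U α)
    (hdiag : ∀ W : Set (X × X), (∀ x, ∃ N ∈ 𝓝 x, N ×ˢ N ⊆ W) → W ∈ 𝓤 X)
    (hGd : ∀ x : X, ∃ G : ℕ → Set X, (∀ n, G n ∈ 𝓝 x) ∧ ⋂ n, G n ⊆ {x}) :
    ∃ S : Set (Set X), S.Countable ∧ (∀ K ∈ S, IsCompact K) ∧ ⋃₀ S = univ := by
  let P : List ℕ → Set X := fun s => {x | ∃ A ∈ 𝓝 x, Capt U s A}
  let E : List ℕ → Set X := fun s => {x | x ∈ P s ∧ ∀ i, x ∉ P (s ++ [i])}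
  have hPo : ∀ s, IsOpen (P s) := by
    intro s
    rw [isOpen_iff_mem_nhds]
    rintro x ⟨A, hA, hc⟩
    filter_upwards [eventually_mem_nhds_iff.2 hA] with y hy
    exact ⟨A, hy, hc⟩
  have hE : ∀ s, ∃ S : Set (Set X), S.Countable ∧ (∀ K ∈ S, IsCompact K) ∧ E s ⊆ ⋃₀ S := by
    intro s
    have hex : ∀ x, ∃ C : Set X, x ∈ E s → C ∈ 𝓝 x ∧ IsCompact (C ∩ E s) := by
      intro x
      by_cases hx : x ∈ E s
      · obtain ⟨⟨A, hA, hcA⟩, -⟩ := id hx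
        obtain ⟨C, hC, hCc, hCA⟩ := exists_mem_nhds_isClosed_subset (interior_mem_nhds.2 hA)
        refine ⟨C, fun _ => ⟨hC, ?_⟩⟩
        have hcO : Capt U s (interior A) := hcA.mono interior_subset
        have heq : C ∩ E s = C ∩ ⋂ i, (P (s ++ [i]))ᶜ := by
          ext y
          simp only [mem_inter_iff, mem_iInter, mem_compl_iff]
          refine and_congr_right fun hy => ⟨fun h => h.2, fun h => ⟨?_, h⟩⟩
          exact ⟨interior A, isOpen_interior.mem_nhds (hCA hy), hcO⟩
        refine compact_piece hX hdiag isOpen_interior hcO (inter_subset_left.trans hCA) ?_ ?_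
        · rw [heq]
          exact hCc.inter (isClosed_iInter fun i => (hPo _).isClosed_compl)
        · rintro y ⟨-, hy⟩ i B hB hcB
          exact hy.2 i ⟨B, hB, hcB⟩
      · exact ⟨∅, fun h => absurd h hx⟩
    choose C hC using hex
    obtain ⟨T, hTE, hTc, hT⟩ := hX.cover (E s) C (fun x hx => (hC x hx).1)
    refine ⟨(fun x => C x ∩ E s) '' T, hTc.image _, ?_, ?_⟩
    · rintro _ ⟨x, hx, rfl⟩
      exact (hC x (hTE hx)).2
    · intro y hy
      obtain ⟨x, hx, hyx⟩ := mem_iUnion₂.1 (hT hy)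
      exact ⟨_, mem_image_of_mem _ hx, hyx, hy⟩
  choose S hSc hSK hSE using hE
  obtain ⟨T, hTI, hTc, hT⟩ := hX.cover {x : X | ({x} : Set X) ∈ 𝓝 x} (fun x => {x}) (fun x hx => hx)
  refine ⟨(⋃ s, S s) ∪ (fun x : X => ({x} : Set X)) '' T, (countable_iUnion hSc).union (hTc.image _), ?_, ?_⟩
  · rintro K (hK | ⟨x, -, rfl⟩)
    · obtain ⟨s, hs⟩ := mem_iUnion.1 hK
      exact hSK s K hs
    · exact isCompact_singleton
  · rw [eq_univ_iff_forall]
    intro x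
    by_cases hx : ∃ s, x ∈ E s
    · obtain ⟨s, hs⟩ := hx
      obtain ⟨K, hK, hxK⟩ := hSE s hs
      exact ⟨K, Or.inl (mem_iUnion.2 ⟨s, hK⟩), hxK⟩
    · have hstep : ∀ s, ∃ i, x ∈ P s → x ∈ P (s ++ [i]) := by
        intro s
        by_contra! hcon
        exact hx ⟨s, (hcon 0).1, fun i => (hcon i).2⟩
      choose step hstep using hstep
      let q : ℕ → List ℕ := fun n => Nat.rec [] (fun _ l => l ++ [step l]) n
      let α : ℕ → ℕ := fun n => step (q n)
      have hq : ∀ n, q n = (List.range n).map α := by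
        intro n
        induction n with
        | zero => rfl
        | succ n ih =>
          rw [List.range_succ, List.map_append, ← ih]
          rfl
      have hPq : ∀ n, x ∈ P (q n) := by
        intro n
        induction n with
        | zero =>
          refine ⟨univ, univ_mem, fun V hV => ?_⟩
          obtain ⟨β, hβ⟩ := hbase V hV
          refine ⟨β, fun i hi => ?_, fun x _ y _ h => hβ h⟩
          exact absurd hi (Nat.not_lt_zero i)
        | succ n ih => exact hstep _ ih
      choose A hA hcA using hPq
      obtain ⟨G, hG, hGx⟩ := hGd x
      have hiso : {x} ∈ 𝓝 x := isolated_of_branch hU hmono x G hG hGx α A hA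
        (fun n => by rw [← hq]; exact hcA n)
      obtain ⟨y, hy, hxy⟩ := mem_iUnion₂.1 (hT hiso)
      exact ⟨{y}, Or.inr ⟨y, hy, rfl⟩, hxy⟩

/-- If `C_p(X)` is analytic then `X` is cosmic. -/
lemma cosmic_of_analytic {X : Type*} [TopologicalSpace X] [CompletelyRegularSpace X]
    (h : AnalyticSpace {f : X → ℝ // Continuous f}) : Cosmic X := by
  obtain ⟨P, _, hP, g, hg, hsurj⟩ := h
  refine ⟨(fun B : Set P => {x | ∀ p ∈ B, (g p).1 x < 1 / 2}) '' TopologicalSpace.countableBasis P,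
    (TopologicalSpace.countable_countableBasis P).image _, fun y U hU hy => ?_⟩
  obtain ⟨f, hf, hfx, hf1⟩ := CompletelyRegularSpace.completely_regular y Uᶜ
      hU.isClosed_compl (by simpa using hy)
  obtain ⟨p, hp⟩ := hsurj ⟨fun x => (f x : ℝ), by fun_prop⟩
  have hopen : IsOpen {p : P | (g p).1 y < 1 / 2} :=
    isOpen_lt ((continuous_apply y).comp (continuous_subtype_val.comp hg)) continuous_const
  obtain ⟨B, hB, hpB, hBs⟩ := (TopologicalSpace.isBasis_countableBasis P).exists_subset_of_mem_open
    (show p ∈ {p : P | (g p).1 y < 1 / 2} by simp [hp, hfx]) hopen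
  refine ⟨_, mem_image_of_mem _ hB, fun q hq => hBs hq, fun z hz => ?_⟩
  by_contra hcon
  have h1 := hz p hpB
  have h2 : f z = 1 := hf1 hcon
  simp [hp, h2] at h1
  norm_num at h1

/-- If `C_p(X)` is analytic then `X` admits a continuous injection to a metrizable space. -/
lemma injection_of_analytic {X : Type*} [TopologicalSpace X] [CompletelyRegularSpace X]
    [T2Space X] (h : AnalyticSpace {f : X → ℝ // Continuous f}) :
    ∃ Φ : X → (ℕ → ℝ), Continuous Φ ∧ Function.Injective Φ := by
  obtain ⟨P, _, hP, g, hg, hsurj⟩ := h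
  have : Nonempty P := ⟨(hsurj ⟨fun _ => 0, continuous_const⟩).choose⟩
  refine ⟨fun x n => (g (TopologicalSpace.denseSeq P n)).1 x,
    continuous_pi fun n => (g _).2, fun x y hxy => ?_⟩
  by_contra hne
  obtain ⟨f, hf, hfx, hf1⟩ := CompletelyRegularSpace.completely_regular x {y}
      isClosed_singleton (by simpa using hne)
  obtain ⟨p, hp⟩ := hsurj ⟨fun x => (f x : ℝ), by fun_prop⟩
  have hcl : IsClosed {p : P | (g p).1 x = (g p).1 y} :=
    isClosed_eq ((continuous_apply x).comp (continuous_subtype_val.comp hg))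
      ((continuous_apply y).comp (continuous_subtype_val.comp hg))
  have hall : ∀ p, (g p).1 x = (g p).1 y := fun p =>
    hcl.closure_subset_iff.2 (range_subset_iff.2 fun n => congrFun hxy n)
      (TopologicalSpace.denseRange_denseSeq P p)
  have h1 := hall p
  have h2 : f y = 1 := hf1 rfl
  simp [hp, hfx, h2] at h1

section analytic

set_option linter.unusedSectionVars false

variable {X : Type*} [UniformSpace X]

/-- The compact resolution of `C_p(X)`. -/
def Res (U : (ℕ → ℕ) → Set (X × X)) (e : ℕ → X) (γ : ℕ → ℕ) : Set (X → ℝ) :=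
  {f | (∀ i, |f (e i)| ≤ γ (Nat.pair 0 i)) ∧
    ∀ k x y, (x, y) ∈ U (fun i => γ (Nat.pair (k + 1) i)) → |f x - f y| ≤ 1 / ((k : ℝ) + 1)}

lemma Res.mono {U : (ℕ → ℕ) → Set (X × X)} {e : ℕ → X}
    (hmono : ∀ α β : ℕ → ℕ, α ≤ β → U β ⊆ U α) {γ δ : ℕ → ℕ} (h : γ ≤ δ) :
    Res U e γ ⊆ Res U e δ := by
  rintro f ⟨h1, h2⟩
  refine ⟨fun i => (h1 i).trans (by exact_mod_cast h _), fun k x y hxy => h2 k x y ?_⟩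
  exact hmono _ _ (fun i => h _) hxy

lemma Res.continuous {U : (ℕ → ℕ) → Set (X × X)} {e : ℕ → X} (hU : ∀ α, U α ∈ 𝓤 X)
    {γ : ℕ → ℕ} {f : X → ℝ} (hf : f ∈ Res U e γ) : Continuous f := by
  refine UniformContinuous.continuous ?_
  refine Metric.uniformity_basis_dist.tendsto_right_iff.2 fun ε hε => ?_
  obtain ⟨k, hk⟩ := exists_nat_one_div_lt hε
  filter_upwards [hU (fun i => γ (Nat.pair (k + 1) i))] with q hq
  exact (hf.2 k q.1 q.2 hq).trans_lt hk

lemma Res.isCompact {U : (ℕ → ℕ) → Set (X × X)} {e : ℕ → X} (hU : ∀ α, U α ∈ 𝓤 X)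
    (he : DenseRange e) (γ : ℕ → ℕ) : IsCompact (Res U e γ) := by
  have hcl : IsClosed (Res U e γ) := by
    have : Res U e γ = (⋂ i, {f : X → ℝ | |f (e i)| ≤ γ (Nat.pair 0 i)}) ∩
      ⋂ k : ℕ, ⋂ x, ⋂ y, ⋂ _ : (x, y) ∈ U (fun i => γ (Nat.pair (k + 1) i)),
        {f : X → ℝ | |f x - f y| ≤ 1 / ((k : ℝ) + 1)} := by
      ext f
      simp [Res]
    rw [this]
    refine (isClosed_iInter fun i => ?_).inter (isClosed_iInter fun k => isClosed_iInter fun x =>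
      isClosed_iInter fun y => isClosed_iInter fun _ => ?_)
    · exact isClosed_le (by fun_prop) continuous_const
    · exact isClosed_le (by fun_prop) continuous_const
  have hb : ∀ x, ∃ M : ℝ, ∀ f ∈ Res U e γ, |f x| ≤ M := by
    intro x
    have hx : {y | (x, y) ∈ U (fun i => γ (Nat.pair (0 + 1) i))} ∈ 𝓝 x :=
      UniformSpace.ball_mem_nhds x (hU _)
    obtain ⟨i, hi⟩ := he.exists_mem_open isOpen_interior
      ⟨x, mem_interior_iff_mem_nhds.2 hx⟩
    refine ⟨γ (Nat.pair 0 i) + 1, fun f hf => ?_⟩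
    have h1 := hf.1 i
    have hi' := interior_subset hi
    have h2 := hf.2 0 x (e i) hi'
    simp only [Nat.cast_zero, zero_add, div_one] at h2
    rw [abs_le] at h1 h2 ⊢
    constructor <;> linarith [h1.1, h1.2, h2.1, h2.2]
  choose M hM using hb
  refine (isCompact_univ_pi fun x => isCompact_Icc (a := -M x) (b := M x)).of_isClosed_subset hcl ?_
  intro f hf x _
  exact abs_le.1 (hM x f hf)

lemma Res.exists_mem {U : (ℕ → ℕ) → Set (X × X)} {e : ℕ → X}
    (hbase : ∀ V ∈ 𝓤 X, ∃ α, U α ⊆ V)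
    (hfine : ∀ d : X → X → ℝ, (∀ x, d x x = 0) → (∀ x y, d x y = d y x) →
        (∀ x y z, d x z ≤ d x y + d y z) →
        Continuous (fun p : X × X => d p.1 p.2) →
        ∀ ε : ℝ, 0 < ε → {p : X × X | d p.1 p.2 < ε} ∈ 𝓤 X)
    {f : X → ℝ} (hf : Continuous f) : ∃ γ, f ∈ Res U e γ := by
  have h1 : ∀ k : ℕ, ∃ α, U α ⊆ {p : X × X | |f p.1 - f p.2| < 1 / ((k : ℝ) + 1)} := fun k =>
    hbase _ (hfine (fun x y => |f x - f y|) (by simp) (fun x y => abs_sub_comm _ _)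
      (fun x y z => abs_sub_le _ _ _)
      (((hf.comp continuous_fst).sub (hf.comp continuous_snd)).abs) _ (by positivity))
  choose α hα using h1
  refine ⟨fun m => Nat.casesOn (Nat.unpair m).1 ⌈|f (e (Nat.unpair m).2)|⌉₊
    (fun k => α k (Nat.unpair m).2), fun i => ?_, fun k x y hxy => ?_⟩
  · simpa using Nat.le_ceil |f (e i)|
  · simp only [Nat.unpair_pair] at hxy
    exact (hα k hxy).le

/-- Restriction to the dense sequence. -/
def Rst (e : ℕ → X) (f : X → ℝ) : ℕ → ℝ := fun n => f (e n)

lemma Rst.cont (e : ℕ → X) : Continuous (Rst e) := continuous_pi fun n => continuous_apply (e n)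

lemma Rst.inj {e : ℕ → X} (he : DenseRange e) {f g : X → ℝ} (hf : Continuous f)
    (hg : Continuous g) (h : Rst e f = Rst e g) : f = g :=
  he.equalizer hf hg h

/-- Unions of the resolution over cylinders. -/
def RU (U : (ℕ → ℕ) → Set (X × X)) (e : ℕ → X) (α : ℕ → ℕ) (n : ℕ) : Set (X → ℝ) :=
  {f | ∃ β : ℕ → ℕ, (∀ i < n, β i = α i) ∧ f ∈ Res U e β}

/-- The Polish space parametrizing `C_p(X)`. -/
def PP (U : (ℕ → ℕ) → Set (X × X)) (e : ℕ → X) : Set ((ℕ → ℕ) × (ℕ → ℝ)) :=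
  {q | ∀ n, q.2 ∈ closure (Rst e '' RU U e q.1 n)}

lemma eventually_agree {α : ℕ → ℕ} {a : ℕ → ℕ → ℕ} (h : Tendsto a atTop (𝓝 α)) (n : ℕ) :
    ∀ᶠ m in atTop, ∀ i < n, a m i = α i := by
  have h' : ∀ i ∈ Finset.range n, ∀ᶠ m in atTop, a m i = α i := fun i _ => by
    have := tendsto_pi_nhds.1 h i
    rw [nhds_discrete, tendsto_pure] at this
    exact this
  filter_upwards [(Finset.eventually_all _).2 h'] with m hm i hi
  exact hm i (Finset.mem_range.2 hi)

lemma PP.isClosed (U : (ℕ → ℕ) → Set (X × X)) (e : ℕ → X) : IsClosed (PP U e) := by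
  refine IsSeqClosed.isClosed fun q p hq hp n => ?_
  have h1 : Tendsto (fun m => (q m).1) atTop (𝓝 p.1) := (continuous_fst.tendsto p).comp hp
  have h2 : Tendsto (fun m => (q m).2) atTop (𝓝 p.2) := (continuous_snd.tendsto p).comp hp
  refine isClosed_closure.mem_of_tendsto h2 ?_
  filter_upwards [eventually_agree h1 n] with m hm
  have : RU U e (q m).1 n = RU U e p.1 n := by
    ext f
    constructor
    · rintro ⟨β, hβ, hf⟩
      exact ⟨β, fun i hi => (hβ i hi).trans (hm i hi), hf⟩
    · rintro ⟨β, hβ, hf⟩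
      exact ⟨β, fun i hi => (hβ i hi).trans (hm i hi).symm, hf⟩
  rw [← this]
  exact hq m n

lemma PP.lift {U : (ℕ → ℕ) → Set (X × X)} {e : ℕ → X} (hU : ∀ α, U α ∈ 𝓤 X)
    (hmono : ∀ α β : ℕ → ℕ, α ≤ β → U β ⊆ U α)
    (he : DenseRange e) {q : (ℕ → ℕ) × (ℕ → ℝ)} (hq : q ∈ PP U e) (n : ℕ) :
    ∃ β : ℕ → ℕ, (∀ i < n, β i = q.1 i) ∧ q.2 ∈ Rst e '' Res U e β := by
  obtain ⟨b, hb⟩ := (𝓝 q.2).exists_antitone_basis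
  have hex : ∀ m, ∃ f β, (∀ i < n + m, β i = q.1 i) ∧ f ∈ Res U e β ∧ Rst e f ∈ b m := by
    intro m
    obtain ⟨_, hz, f, ⟨β, hβ, hf⟩, rfl⟩ := mem_closure_iff_nhds.1 (hq (n + m)) (b m)
      (hb.1.mem_of_mem trivial)
    exact ⟨f, β, hβ, hf, hz⟩
  choose f β hβ hf hfb using hex
  obtain ⟨γ, hγ, hγn⟩ := exists_sup q.1 n β hβ
  refine ⟨γ, hγn, ?_⟩
  have hc : IsClosed (Rst e '' Res U e γ) :=
    ((Res.isCompact hU he γ).image (Rst.cont e)).isClosed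
  exact hc.mem_of_tendsto (hb.tendsto hfb)
    (Eventually.of_forall fun m => mem_image_of_mem _ (Res.mono hmono (hγ m) (hf m)))

lemma analytic_Cp [Nonempty X] [TopologicalSpace.SeparableSpace X]
    {U : (ℕ → ℕ) → Set (X × X)} (hU : ∀ α, U α ∈ 𝓤 X)
    (hbase : ∀ V ∈ 𝓤 X, ∃ α, U α ⊆ V)
    (hmono : ∀ α β : ℕ → ℕ, α ≤ β → U β ⊆ U α)
    (hfine : ∀ d : X → X → ℝ, (∀ x, d x x = 0) → (∀ x y, d x y = d y x) →
        (∀ x y z, d x z ≤ d x y + d y z) →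
        Continuous (fun p : X × X => d p.1 p.2) →
        ∀ ε : ℝ, 0 < ε → {p : X × X | d p.1 p.2 < ε} ∈ 𝓤 X) :
    AnalyticSpace {f : X → ℝ // Continuous f} := by
  let e := TopologicalSpace.denseSeq X
  have he : DenseRange e := TopologicalSpace.denseRange_denseSeq X
  have hlift : ∀ q : PP U e, ∃ f : {f : X → ℝ // Continuous f}, Rst e f.1 = q.1.2 := by
    intro q
    obtain ⟨β, -, f, hf, hfq⟩ := PP.lift hU hmono he q.2 0
    exact ⟨⟨f, Res.continuous hU hf⟩, hfq⟩
  choose F hF using hlift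
  have hF' : ∀ q : PP U e, ∀ n, ∃ β : ℕ → ℕ, (∀ i < n, β i = q.1.1 i) ∧ (F q).1 ∈ Res U e β := by
    intro q n
    obtain ⟨β, hβ, f, hf, hfq⟩ := PP.lift hU hmono he q.2 n
    refine ⟨β, hβ, ?_⟩
    rwa [Rst.inj he (F q).2 (Res.continuous hU hf) ((hF q).trans hfq.symm)]
  refine ⟨PP U e, inferInstance, (PP.isClosed U e).polishSpace, F, ?_, ?_⟩
  · refine continuous_iff_seqContinuous.2 fun q p hqp => ?_
    have hqp' : Tendsto (fun m => (q m).1) atTop (𝓝 p.1) :=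
      (continuous_subtype_val.tendsto p).comp hqp
    have h1 : Tendsto (fun m => (q m).1.1) atTop (𝓝 p.1.1) := (continuous_fst.tendsto p.1).comp hqp'
    have h2 : Tendsto (fun m => (q m).1.2) atTop (𝓝 p.1.2) := (continuous_snd.tendsto p.1).comp hqp'
    choose β hβ hFβ using fun m => hF' (q m) m
    have hbd : ∀ i, ∃ B, ∀ m, β m i ≤ B := by
      intro i
      obtain ⟨m0, hm0⟩ := eventually_atTop.1 (eventually_agree h1 (i + 1))
      refine ⟨p.1.1 i ⊔ (Finset.range (m0 + i + 1)).sup fun m => β m i, fun m => ?_⟩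
      by_cases hm : m < m0 + i + 1
      · exact le_sup_of_le_right
          (Finset.le_sup (f := fun m => β m i) (Finset.mem_range.2 hm))
      · refine le_sup_of_le_left ?_
        rw [hβ m i (by omega), hm0 m (by omega) i (by omega)]
    choose γ hγ using hbd
    have hm : ∀ m, (F (q m)).1 ∈ Res U e γ := fun m => Res.mono hmono (fun i => hγ i m) (hFβ m)
    have hK := Res.isCompact hU he γ
    have hcl : IsClosed (Rst e '' Res U e γ) := (hK.image (Rst.cont e)).isClosed
    have hp : (F p).1 ∈ Res U e γ := by
      obtain ⟨f, hf, hfp⟩ : p.1.2 ∈ Rst e '' Res U e γ := hcl.mem_of_tendsto h2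
        (Eventually.of_forall fun m => ⟨_, hm m, hF (q m)⟩)
      rwa [Rst.inj he (F p).2 (Res.continuous hU hf) ((hF p).trans hfp.symm)]
    have : CompactSpace (Res U e γ) := isCompact_iff_compactSpace.1 hK
    have hemb : IsClosedEmbedding (fun f : Res U e γ => Rst e f.1) :=
      ((Rst.cont e).comp continuous_subtype_val).isClosedEmbedding fun f g hfg =>
        Subtype.ext (Rst.inj he (Res.continuous hU f.2) (Res.continuous hU g.2) hfg)
    have ht : Tendsto (fun m => (⟨(F (q m)).1, hm m⟩ : Res U e γ)) atTop (𝓝 ⟨(F p).1, hp⟩) := by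
      rw [hemb.isEmbedding.tendsto_nhds_iff]
      simpa [Function.comp_def, hF] using h2
    rw [tendsto_subtype_rng] at ht ⊢
    exact ht
  · intro f
    obtain ⟨γ, hγ⟩ := Res.exists_mem (e := e) hbase hfine f.2
    let q : PP U e := ⟨(γ, Rst e f.1), fun n => subset_closure ⟨f.1, ⟨γ, fun _ _ => rfl, hγ⟩, rfl⟩⟩
    exact ⟨q, Subtype.ext (Rst.inj he (F q).2 f.2 (hF q))⟩

end analytic

/-- If the finest compatible uniformity of a separable completely regular Hausdorff
space `X` has a `𝔊`-base, then `C_p(X)` is analytic and `X` is cosmic and σ-compact; in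
particular, `X` is a countable union of compact metrizable subspaces. -/
theorem analytic_Cp_cosmic_sigmaCompact_of_separable_gBase
    {X : Type*} [t : TopologicalSpace X] [CompletelyRegularSpace X] [T2Space X]
    [TopologicalSpace.SeparableSpace X]
    (hfine : ∃ u : UniformSpace X, u.toTopologicalSpace = t ∧
      (∀ d : X → X → ℝ, (∀ x, d x x = 0) → (∀ x y, d x y = d y x) →
        (∀ x y z, d x z ≤ d x y + d y z) →
        Continuous (fun p : X × X => d p.1 p.2) →
        ∀ ε : ℝ, 0 < ε → {p : X × X | d p.1 p.2 < ε} ∈ @uniformity X u) ∧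
      ∃ U : (ℕ → ℕ) → Set (X × X), (∀ α, U α ∈ @uniformity X u) ∧
        (∀ V ∈ @uniformity X u, ∃ α, U α ⊆ V) ∧
        ∀ α β : ℕ → ℕ, α ≤ β → U β ⊆ U α) :
    AnalyticSpace {f : X → ℝ // Continuous f} ∧ Cosmic X ∧ SigmaCompactSpace X ∧
    ∃ K : ℕ → Set X, (∀ n, IsCompact (K n) ∧ TopologicalSpace.MetrizableSpace (K n)) ∧
      (⋃ n, K n) = Set.univ := by
  obtain ⟨u, rfl, hfine, U, hU, hbase, hmono⟩ := hfine
  have hA : AnalyticSpace {f : X → ℝ // Continuous f} := by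
    rcases isEmpty_or_nonempty X with hE | hE
    · exact ⟨Unit, inferInstance, inferInstance, fun _ => ⟨fun _ => 0, continuous_const⟩,
        continuous_const, fun f => ⟨(), Subtype.ext (funext fun x => (hE.false x).elim)⟩⟩
    · exact analytic_Cp hU hbase hmono hfine
  have hC : Cosmic X := cosmic_of_analytic hA
  obtain ⟨Φ, hΦ, hinj⟩ := injection_of_analytic hA
  have hS : SigmaCompactSpace X := by
    rcases isEmpty_or_nonempty X with hE | hE
    · infer_instance
    have hGd : ∀ x : X, ∃ G : ℕ → Set X, (∀ n, G n ∈ 𝓝 x) ∧ ⋂ n, G n ⊆ {x} := by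
      intro x
      obtain ⟨b, hb⟩ := (𝓝 (Φ x)).exists_antitone_basis
      refine ⟨fun n => Φ ⁻¹' b n, fun n => hΦ.continuousAt.preimage_mem_nhds (hb.1.mem_of_mem trivial),
        fun y hy => hinj ?_⟩
      by_contra hne
      obtain ⟨n, -, hn⟩ := hb.1.mem_iff.1 (isOpen_compl_singleton.mem_nhds (Ne.symm hne))
      exact hn (mem_iInter.1 hy n) rfl
    obtain ⟨S, hSc, hSK, hSu⟩ := countable_compact_cover hC hU hbase hmono
      (diag_nhds_mem_uniformity hC hfine) hGd
    exact SigmaCompactSpace.of_countable S hSc hSK hSu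
  refine ⟨hA, hC, hS, compactCovering X, fun n => ⟨isCompact_compactCovering X n, ?_⟩,
    iUnion_compactCovering X⟩
  have : CompactSpace (compactCovering X n) :=
    isCompact_iff_compactSpace.1 (isCompact_compactCovering X n)
  have hemb : IsClosedEmbedding (fun x : compactCovering X n => Φ x.1) :=
    (hΦ.comp continuous_subtype_val).isClosedEmbedding (hinj.comp Subtype.val_injective)
  exact hemb.isEmbedding.metrizableSpace
end

section
/- Assume ω₁ < 𝔟, i.e., every subset B ⊆ ω^ω of cardinality at most ℵ₁ is dominated by a countable set: there exists a countable C ⊆ ω^ω such that every f ∈ B satisfies f ≤ g for some g ∈ C. Let X be a completely regular Hausdorff space whose finest compatible uniformity is ω-narrow and has a 𝔊-base, i.e., there is a uniformity 𝒰 on X inducing the topology of X such that every continuous pseudometric on X is uniformly continuous with respect to 𝒰, 𝒰 is ω-narrow and 𝒰 has a 𝔊-base. Then X is cosmic and σ-compact. -/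
/-- A sequence of functions agreeing longer and longer with `a` is bounded. -/
lemma gb_sup (a : ℕ → ℕ) (b : ℕ → ℕ → ℕ) (h : ∀ k, ∀ i < k, b k i = a i) :
    ∃ c : ℕ → ℕ, a ≤ c ∧ ∀ k, b k ≤ c := by
  refine ⟨fun i => a i + ∑ k ∈ Finset.range (i + 1), b k i, fun i => by simp, fun k i => ?_⟩
  by_cases hk : i < k
  · simp [h k i hk]
  · have := Finset.single_le_sum (f := fun k => b k i) (fun _ _ => Nat.zero_le _)
      (Finset.mem_range.2 (show k < i + 1 by omega))
    simp only at this ⊢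
    omega

/-- Step 1: a countable dense sequence. -/
lemma gb_separable {X : Type*} [UniformSpace X] [CompletelyRegularSpace X]
    (hb : ∀ B : Set (ℕ → ℕ), Cardinal.mk ↥B ≤ Cardinal.aleph 1 →
      ∃ C : Set (ℕ → ℕ), C.Countable ∧ ∀ f ∈ B, ∃ g ∈ C, f ≤ g)
    (U : (ℕ → ℕ) → Set (X × X)) (hU : ∀ α, U α ∈ uniformity X)
    (hmono : ∀ α β : ℕ → ℕ, α ≤ β → U β ⊆ U α)
    (hfun : ∀ f : X → ℝ, Continuous f → ∃ α, ∀ p ∈ U α, |f p.1 - f p.2| < 1/8)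
    (hnar : ∀ U ∈ uniformity X, ∃ C : Set X, C.Countable ∧ ∀ x : X, ∃ c ∈ C, (c, x) ∈ U) :
    ∃ D : Set X, D.Countable ∧ Dense D := by
  by_contra hcon
  push Not at hcon
  have h1 : ∀ C : Set X, ∃ x, C.Countable → x ∉ closure C := by
    intro C
    by_cases hC : C.Countable
    · have := hcon C hC
      rw [Dense] at this
      push Not at this
      obtain ⟨x, hx⟩ := this
      exact ⟨x, fun _ => hx⟩
    · have := hcon ∅ Set.countable_empty
      rw [Dense] at this
      push Not at this
      obtain ⟨x, hx⟩ := this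
      exact ⟨x, fun h => absurd h hC⟩
  choose pick hpick using h1
  let Ω : Type := (Cardinal.aleph 1).ord.ToType
  have hcard : Cardinal.mk Ω = Cardinal.aleph 1 := Cardinal.mk_ord_toType _
  have hIio : ∀ ξ : Ω, (Set.Iio ξ).Countable := by
    intro ξ
    rw [← Cardinal.le_aleph0_iff_set_countable]
    have h := Cardinal.mk_Iio_toType_ord_lt ξ
    exact Order.lt_succ_iff.1 (h.trans_eq Cardinal.succ_aleph0.symm)
  let x : Ω → X := (wellFounded_lt (α := Ω)).fix
    (fun ξ ih => pick (Set.range fun η : Set.Iio ξ => ih η.1 η.2))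
  have hx : ∀ ξ, x ξ = pick (x '' Set.Iio ξ) := by
    intro ξ
    have := (wellFounded_lt (α := Ω)).fix_eq
      (fun ξ ih => pick (Set.range fun η : Set.Iio ξ => ih η.1 η.2)) ξ
    rw [Set.image_eq_range]
    exact this
  have hx' : ∀ ξ, x ξ ∉ closure (x '' Set.Iio ξ) := by
    intro ξ
    have := hpick _ ((hIio ξ).image x)
    rwa [← hx] at this
  have hf : ∀ ξ, ∃ f : X → ℝ, Continuous f ∧ f (x ξ) = 0 ∧ ∀ η < ξ, f (x η) = 1 := by
    intro ξ
    obtain ⟨f, hf, h0, h1⟩ := CompletelyRegularSpace.completely_regular _ _ isClosed_closure (hx' ξ)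
    refine ⟨fun y => (f y : ℝ), by fun_prop, by simp [h0], fun η hη => ?_⟩
    have := h1 (subset_closure (Set.mem_image_of_mem x hη))
    simp [this]
  choose f hfc hf0 hf1 using hf
  choose a ha using fun ξ => hfun (f ξ) (hfc ξ)
  obtain ⟨C, hC, hCd⟩ := hb (Set.range a) (Cardinal.mk_range_le.trans hcard.le)
  choose g hgC hag using fun ξ => hCd (a ξ) ⟨ξ, rfl⟩
  have hV : ∀ α, ∃ (S : Set X) (c : X → X), S.Countable ∧ (∀ x, c x ∈ S) ∧
      ∀ x y, c x = c y → (x, y) ∈ U α := by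
    intro α
    obtain ⟨V, hV, hsym, hVU⟩ := comp_symm_mem_uniformity_sets (hU α)
    obtain ⟨S, hS, hSc⟩ := hnar V hV
    choose c hcS hc using hSc
    refine ⟨S, c, hS, hcS, fun x y hxy => hVU ⟨c x, ?_, ?_⟩⟩
    · exact hsym.symm _ _ (hc x)
    · rw [hxy]; exact hc y
  choose S c hS hcS hc using hV
  have hcount : (⋃ α ∈ C, (Prod.mk α '' S α)).Countable :=
    hC.biUnion fun α _ => (hS α).image _
  let φ : Ω → (⋃ α ∈ C, (Prod.mk α '' S α)) := fun ξ =>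
    ⟨(g ξ, c (g ξ) (x ξ)), by
      simp only [Set.mem_iUnion]
      exact ⟨g ξ, hgC ξ, _, hcS _ _, rfl⟩⟩
  have key : ∀ ξ η, η < ξ → φ ξ ≠ φ η := by
    intro ξ η hlt heq
    have h1 := congrArg Subtype.val heq
    simp only [φ, Prod.mk.injEq] at h1
    obtain ⟨h2, h3⟩ := h1
    rw [← h2] at h3
    have h4 := ha ξ _ (hmono _ _ (hag ξ) (hc _ _ _ h3))
    simp only [hf0, hf1 ξ η hlt] at h4
    norm_num at h4
  have hinj : Function.Injective φ := by
    intro ξ η h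
    rcases lt_trichotomy ξ η with h' | h' | h'
    · exact absurd h.symm (key _ _ h')
    · exact h'
    · exact absurd h (key _ _ h')
  have := hcount.to_subtype
  have hc2 : Countable Ω := hinj.countable
  have := Cardinal.mk_le_aleph0_iff.2 hc2
  rw [hcard] at this
  exact absurd Cardinal.aleph0_lt_aleph_one (not_lt.2 this)

/-- Step 2: cosmic. -/
lemma gb_cosmic {X : Type*} [UniformSpace X] [CompletelyRegularSpace X]
    (U : (ℕ → ℕ) → Set (X × X))
    (hmono : ∀ α β : ℕ → ℕ, α ≤ β → U β ⊆ U α)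
    (hfun : ∀ f : X → ℝ, Continuous f → ∃ α, ∀ p ∈ U α, |f p.1 - f p.2| < 1/8)
    (d : ℕ → X) (hd : ∀ α x, ∃ i, (d i, x) ∈ U α) :
    ∃ N : Set (Set X), N.Countable ∧
      ∀ y : X, ∀ U : Set X, IsOpen U → y ∈ U → ∃ s ∈ N, y ∈ s ∧ s ⊆ U := by
  let M : (Σ n : ℕ, (Fin n → ℕ) × (Fin n → ℤ)) → Set X := fun q =>
    {y | ∀ (g : X → ℝ) (β : ℕ → ℕ), (∀ i : Fin q.1, β i = q.2.1 i) →
      (∀ i : Fin q.1, ⌊16 * g (d i)⌋ = q.2.2 i) → (∀ p ∈ U β, |g p.1 - g p.2| < 1/8) → g y < 1/2}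
  refine ⟨Set.range M, Set.countable_range M, fun x W hW hx => ?_⟩
  obtain ⟨f', hf', h0, h1⟩ := CompletelyRegularSpace.completely_regular x Wᶜ hW.isClosed_compl
    (by simpa using hx)
  obtain ⟨f, hf⟩ : ∃ f : X → ℝ, f = fun y => (f' y : ℝ) := ⟨_, rfl⟩
  have hfc : Continuous f := by rw [hf]; fun_prop
  have hf0 : f x = 0 := by simp [hf, h0]
  have hf1 : ∀ y, y ∉ W → f y = 1 := by
    intro y hy
    have := h1 (show y ∈ Wᶜ from hy)
    simp [hf, this]
  obtain ⟨α, hα⟩ := hfun f hfc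
  by_cases hn : ∃ n : ℕ, x ∈ M ⟨n, fun i => α i, fun i => ⌊16 * f (d i)⌋⟩
  · obtain ⟨n, hn⟩ := hn
    refine ⟨_, ⟨_, rfl⟩, hn, fun y hy => ?_⟩
    have := hy f α (fun _ => rfl) (fun _ => rfl) hα
    by_contra hyW
    rw [hf1 y hyW] at this
    norm_num at this
  · exfalso
    push Not at hn
    simp only [M, Set.mem_ofPred_eq] at hn
    push Not at hn
    choose g β hβ hg hgU hgx using hn
    obtain ⟨γ, hαγ, hγ⟩ := gb_sup α β (fun k i hi => hβ k ⟨i, hi⟩)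
    obtain ⟨i, hi⟩ := hd γ x
    have e1 := hα _ (hmono _ _ hαγ hi)
    have e2 := hgU (i+1) _ (hmono _ _ (hγ (i+1)) hi)
    have e3 := Int.abs_sub_lt_one_of_floor_eq_floor (hg (i+1) ⟨i, by omega⟩)
    have e4 := hgx (i+1)
    simp only [hf0] at e1 e2 e3
    rw [abs_lt] at e1 e2 e3
    linarith [e1.1, e1.2, e2.1, e2.2, e3.1, e3.2]

/-- A space with a countable network is hereditarily Lindelöf. -/
lemma gb_lindelof {X : Type*} [TopologicalSpace X] (N : Set (Set X)) (hN : N.Countable)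
    (hnet : ∀ y : X, ∀ U : Set X, IsOpen U → y ∈ U → ∃ s ∈ N, y ∈ s ∧ s ⊆ U)
    (F : Set (Set X)) (hF : ∀ W ∈ F, IsOpen W) :
    ∃ G ⊆ F, G.Countable ∧ ⋃₀ F ⊆ ⋃₀ G := by
  have : ∀ s : {s // s ∈ N ∧ ∃ W ∈ F, s ⊆ W}, ∃ W ∈ F, s.1 ⊆ W := fun s => s.2.2
  choose w hwF hw using this
  have : Countable {s // s ∈ N ∧ ∃ W ∈ F, s ⊆ W} :=
    (hN.mono (fun s hs => hs.1 : {s | s ∈ N ∧ ∃ W ∈ F, s ⊆ W} ⊆ N)).to_subtype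
  refine ⟨Set.range w, by rintro _ ⟨s, rfl⟩; exact hwF s, Set.countable_range w, ?_⟩
  rintro x ⟨W, hWF, hxW⟩
  obtain ⟨s, hsN, hxs, hsW⟩ := hnet x W (hF W hWF) hxW
  exact ⟨_, ⟨⟨s, hsN, W, hWF, hsW⟩, rfl⟩, hw _ hxs⟩

/-- Increasing open covers. -/
def GBCover {X : Type*} [TopologicalSpace X] (O : ℕ → Set X) : Prop :=
  Monotone O ∧ (∀ n, IsOpen (O n)) ∧ ∀ x, ∃ n, x ∈ O n

/-- `A` is good for the initial segment of `α` of length `k`. -/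
def GBGood {X : Type*} [TopologicalSpace X] (C : (ℕ → ℕ) → ℕ → Set X)
    (k : ℕ) (α : ℕ → ℕ) (A : Set X) : Prop :=
  IsOpen A ∧ ∀ O : ℕ → Set X, GBCover O → A ⊆ O 0 →
    ∃ β : ℕ → ℕ, (∀ i < k, β i = α i) ∧ ∀ m, C β m ⊆ O m

lemma gb_step {X : Type*} [TopologicalSpace X] (C : (ℕ → ℕ) → ℕ → Set X)
    (k : ℕ) (α : ℕ → ℕ) (A : Set X) (hA : GBGood C k α A) (O : ℕ → Set X) (hO : GBCover O) :
    ∃ n, GBGood C (k + 1) (Function.update α k n) (A ∪ O n) := by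
  by_contra hcon
  push Not at hcon
  have h1 : ∀ n, ∃ P : ℕ → Set X, GBCover P ∧ A ∪ O n ⊆ P 0 ∧
      ∀ β : ℕ → ℕ, (∀ i < k + 1, β i = Function.update α k n i) → ¬ ∀ m, C β m ⊆ P m := by
    intro n
    have := hcon n
    simp only [GBGood, not_and] at this
    have := this (hA.1.union (hO.2.1 n))
    push Not at this
    obtain ⟨P, h1, h2, h3⟩ := this
    refine ⟨P, h1, h2, fun β hβ h => ?_⟩
    obtain ⟨m, hm⟩ := h3 β hβ
    exact hm (h m)
  choose P hP hAP hbad using h1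
  have hOP : ∀ n m, m ≤ n → A ∪ O m ⊆ P n m := fun n m hmn =>
    (Set.union_subset_union_right A (hO.1 hmn)).trans ((hAP n).trans ((hP n).1 (Nat.zero_le m)))
  let Q : ℕ → Set X := fun m => (A ∪ O m) ∩ ⋂ n, P n m
  have hQ' : ∀ m, Q m = (A ∪ O m) ∩ ⋂ n ∈ Finset.range m, P n m := by
    intro m
    ext x
    simp only [Q, Set.mem_inter_iff, Set.mem_iInter, Finset.mem_range]
    refine and_congr_right fun hx => ⟨fun h n _ => h n, fun h n => ?_⟩
    by_cases hn : n < m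
    · exact h n hn
    · exact hOP n m (not_lt.1 hn) hx
  have hQ : GBCover Q := by
    refine ⟨?_, ?_, ?_⟩
    · intro a b hab
      refine Set.inter_subset_inter (Set.union_subset_union_right A (hO.1 hab)) ?_
      exact Set.iInter_mono fun n => (hP n).1 hab
    · intro m
      rw [hQ']
      exact (hA.1.union (hO.2.1 m)).inter (isOpen_biInter_finset fun n _ => (hP n).2.1 m)
    · intro x
      obtain ⟨j, hj⟩ := hO.2.2 x
      choose m hm using fun n => (hP n).2.2 x
      refine ⟨j + ∑ n ∈ Finset.range j, m n, Or.inr (hO.1 (by omega) hj), ?_⟩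
      rw [Set.mem_iInter]
      intro n
      by_cases hn : n < j
      · refine (hP n).1 ?_ (hm n)
        have := Finset.single_le_sum (f := m) (fun _ _ => Nat.zero_le _) (Finset.mem_range.2 hn)
        omega
      · refine (hP n).1 (Nat.zero_le _) (hAP n (Or.inr (hO.1 (not_lt.1 hn) hj)))
  obtain ⟨β, hβ, hβQ⟩ := hA.2 Q hQ (by rw [hQ']; simp)
  refine hbad (β k) β (fun i hi => ?_) (fun m => (hβQ m).trans fun x hx => ?_)
  · by_cases hik : i = k
    · subst hik; simp
    · rw [Function.update_of_ne hik]; exact hβ i (by omega)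
  · exact Set.mem_iInter.1 hx.2 (β k)

lemma gb_compact {X : Type*} [TopologicalSpace X] [RegularSpace X]
    (hL : ∀ F : Set (Set X), (∀ W ∈ F, IsOpen W) → ∃ G ⊆ F, G.Countable ∧ ⋃₀ F ⊆ ⋃₀ G)
    (K : Set X) (hK : IsClosed K)
    (h : ∀ O : ℕ → Set X, GBCover O → ∃ n, K ⊆ closure (O n)) : IsCompact K := by
  classical
  apply isCompact_of_finite_subcover
  intro ι W hW hKW
  let F : Set (Set X) := {V | IsOpen V ∧ ((∃ i, closure V ⊆ W i) ∨ closure V ⊆ Kᶜ)}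
  obtain ⟨G, hGF, hG, hFG⟩ := hL F (fun V hV => hV.1)
  have hempty : (∅ : Set X) ∈ F := ⟨isOpen_empty, Or.inr (by simp)⟩
  obtain ⟨V, hV⟩ := (hG.insert ∅).exists_eq_range (Set.insert_nonempty _ _)
  have hVF : ∀ j, V j ∈ F := by
    intro j
    have : V j ∈ insert ∅ G := hV ▸ Set.mem_range_self j
    rcases this with h | h
    · rw [h]; exact hempty
    · exact hGF h
  have hcov : ∀ x, ∃ j, x ∈ V j := by
    intro x
    have hx : x ∈ ⋃₀ F := by
      have hT : ∀ T : Set X, IsOpen T → x ∈ T → ∃ V, IsOpen V ∧ x ∈ V ∧ closure V ⊆ T := by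
        intro T hT hxT
        obtain ⟨s, hs, hsc, hsT⟩ := exists_mem_nhds_isClosed_subset (hT.mem_nhds hxT)
        exact ⟨interior s, isOpen_interior, mem_interior_iff_mem_nhds.2 hs,
          (closure_minimal interior_subset hsc).trans hsT⟩
      by_cases hxK : x ∈ K
      · obtain ⟨i, hi⟩ := Set.mem_iUnion.1 (hKW hxK)
        obtain ⟨V, h1, h2, h3⟩ := hT _ (hW i) hi
        exact ⟨V, ⟨h1, Or.inl ⟨i, h3⟩⟩, h2⟩
      · obtain ⟨V, h1, h2, h3⟩ := hT _ hK.isOpen_compl hxK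
        exact ⟨V, ⟨h1, Or.inr h3⟩, h2⟩
    obtain ⟨T, hT, hxT⟩ := hFG hx
    have : T ∈ Set.range V := hV ▸ Set.mem_insert_of_mem _ hT
    obtain ⟨j, rfl⟩ := this
    exact ⟨j, hxT⟩
  obtain ⟨n, hn⟩ := h (fun n => ⋃ j ∈ Finset.range (n + 1), V j) ⟨by
      intro a b hab
      refine Set.biUnion_subset_biUnion_left fun j hj => ?_
      have : j < a + 1 := Finset.mem_range.1 hj
      exact Finset.mem_range.2 (by omega),
    fun n => isOpen_biUnion fun j _ => (hVF j).1,
    fun x => by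
      obtain ⟨j, hj⟩ := hcov x
      exact ⟨j, Set.mem_biUnion (Finset.self_mem_range_succ j) hj⟩⟩
  rw [Finset.closure_biUnion] at hn
  choose i hi using fun j (hj : ∃ i, closure (V j) ⊆ W i) => hj
  refine ⟨((Finset.range (n + 1)).attach.biUnion fun j =>
    if hj : ∃ i, closure (V j) ⊆ W i then {i j hj} else ∅), fun x hx => ?_⟩
  obtain ⟨j, hj, hxj⟩ := Set.mem_iUnion₂.1 (hn hx)
  rcases (hVF j).2 with h' | h'
  · refine Set.mem_iUnion₂.2 ⟨i j h', ?_, hi j h' hxj⟩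
    rw [Finset.mem_biUnion]
    refine ⟨⟨j, hj⟩, Finset.mem_attach _ _, ?_⟩
    simp [h']
  · exact absurd hx (h' hxj)

lemma gb_sigma {X : Type*} [TopologicalSpace X] [RegularSpace X] [T1Space X]
    (hL : ∀ F : Set (Set X), (∀ W ∈ F, IsOpen W) → ∃ G ⊆ F, G.Countable ∧ ⋃₀ F ⊆ ⋃₀ G)
    (C : (ℕ → ℕ) → ℕ → Set X) (hmono : ∀ α β : ℕ → ℕ, α ≤ β → ∀ m, C β m ⊆ C α m)
    (hCc : ∀ α x, ∃ m, x ∈ C α m)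
    (hC : ∀ O : ℕ → Set X, GBCover O → ∃ α, ∀ m, C α m ⊆ O m) :
    SigmaCompactSpace X := by
  classical
  let R : ℕ → (ℕ → ℕ) × Set X → Set (ℕ × Set X) := fun k p =>
    {q | IsOpen q.2 ∧ GBGood C (k + 1) (Function.update p.1 k q.1) (p.2 ∪ q.2)}
  let K : ℕ → (ℕ → ℕ) × Set X → Set X := fun k p => ⋂ q ∈ R k p, closure q.2
  have hKc : ∀ k p, GBGood C k p.1 p.2 → IsCompact (K k p) := by
    intro k p hp
    refine gb_compact hL _ (isClosed_biInter fun q _ => isClosed_closure) fun O hO => ?_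
    obtain ⟨n, hn⟩ := gb_step C k p.1 p.2 hp O hO
    exact ⟨n, Set.biInter_subset_of_mem (show (n, O n) ∈ R k p from ⟨hO.2.1 n, hn⟩)⟩
  have hch : ∀ k p, ∃ S ⊆ R k p, S.Countable ∧ ∀ x, x ∉ K k p → ∃ q ∈ S, x ∉ closure q.2 := by
    intro k p
    obtain ⟨G, hGF, hG, hFG⟩ := hL ((fun q : ℕ × Set X => (closure q.2)ᶜ) '' R k p) (by
      rintro _ ⟨q, _, rfl⟩
      exact isClosed_closure.isOpen_compl)
    have hGF' : ∀ V : Set X, ∃ q : ℕ × Set X, V ∈ G → q ∈ R k p ∧ (closure q.2)ᶜ = V := by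
      intro V
      by_cases hV : V ∈ G
      · obtain ⟨q, hq, hqV⟩ := hGF hV
        exact ⟨q, fun _ => ⟨hq, hqV⟩⟩
      · exact ⟨(0, ∅), fun h => absurd h hV⟩
    choose r hr using hGF'
    refine ⟨r '' G, ?_, hG.image r, fun x hx => ?_⟩
    · rintro _ ⟨V, hV, rfl⟩
      exact (hr V hV).1
    · simp only [K, Set.mem_iInter, not_forall] at hx
      obtain ⟨q, hq, hxq⟩ := hx
      obtain ⟨V, hV, hxV⟩ := hFG ⟨_, ⟨q, hq, rfl⟩, hxq⟩
      refine ⟨r V, ⟨V, hV, rfl⟩, ?_⟩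
      have := (hr V hV).2
      rw [← this] at hxV
      exact hxV
  choose S hSR hS hSK using hch
  let T : ℕ → Set ((ℕ → ℕ) × Set X) := fun k => Nat.rec {((fun _ => 0), ∅)}
    (fun k Tk => ⋃ p ∈ Tk, (fun q : ℕ × Set X => (Function.update p.1 k q.1, p.2 ∪ q.2)) '' S k p) k
  have hT0 : T 0 = {((fun _ => 0), ∅)} := rfl
  have hTs : ∀ k, T (k + 1) = ⋃ p ∈ T k,
    (fun q : ℕ × Set X => (Function.update p.1 k q.1, p.2 ∪ q.2)) '' S k p := fun k => rfl
  have hTc : ∀ k, (T k).Countable := by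
    intro k
    induction k with
    | zero => rw [hT0]; exact Set.countable_singleton _
    | succ k ih => rw [hTs]; exact ih.biUnion fun p _ => (hS k p).image _
  have hTg : ∀ k, ∀ p ∈ T k, GBGood C k p.1 p.2 := by
    intro k
    cases k with
    | zero =>
      rintro p rfl
      refine ⟨isOpen_empty, fun O hO _ => ?_⟩
      obtain ⟨α, hα⟩ := hC O hO
      exact ⟨α, by simp, hα⟩
    | succ k =>
      intro p hp
      rw [hTs] at hp
      simp only [Set.mem_iUnion] at hp
      obtain ⟨p', hp', q, hq, rfl⟩ := hp
      exact (hSR k p' hq).2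
  have hcov : ∀ x, ∃ k, ∃ p ∈ T k, x ∈ K k p := by
    intro x
    refine Classical.byContradiction fun hx => ?_
    push Not at hx
    have hnext : ∀ k, ∀ p : {p // p ∈ T k ∧ x ∉ p.2}, ∃ p' : {p // p ∈ T (k + 1) ∧ x ∉ p.2},
        ∀ i < k, p'.1.1 i = p.1.1 i := by
      rintro k ⟨p, hp, hxp⟩
      obtain ⟨q, hq, hxq⟩ := hSK k p x (hx k p hp)
      refine ⟨⟨(Function.update p.1 k q.1, p.2 ∪ q.2), ?_, ?_⟩, fun i hi => ?_⟩
      · rw [hTs]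
        exact Set.mem_biUnion hp ⟨q, hq, rfl⟩
      · rintro (h | h)
        · exact hxp h
        · exact hxq (subset_closure h)
      · simp [Function.update_of_ne hi.ne]
    choose next hnext using hnext
    let P : (k : ℕ) → {p // p ∈ T k ∧ x ∉ p.2} := fun k =>
      Nat.rec ⟨((fun _ => 0), ∅), rfl, by simp⟩ next k
    have hPs : ∀ k, ∀ i < k, (P (k + 1)).1.1 i = (P k).1.1 i := fun k => hnext k (P k)
    have hlim : ∀ i j, (P (i + 1 + j)).1.1 i = (P (i + 1)).1.1 i := by
      intro i j
      induction j with
      | zero => rfl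
      | succ j ih => rw [← ih]; exact hPs (i + 1 + j) i (by omega)
    have hbk : ∀ k, ∃ β : ℕ → ℕ, (∀ i < k, β i = (P k).1.1 i) ∧
        ∀ m, C β m ⊆ if m < k then {x}ᶜ else Set.univ := by
      intro k
      refine (hTg k _ (P k).2.1).2 (fun m => if m < k then {x}ᶜ else Set.univ) ⟨?_, ?_, ?_⟩ ?_
      · intro a b hab
        by_cases hb : b < k
        · simp [hb, hab.trans_lt hb]
        · simp [hb]
      · intro n
        by_cases hn : n < k
        · simp only [hn, if_true]; exact isOpen_compl_singleton
        · simp [hn]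
      · intro y
        exact ⟨k, by simp⟩
      · intro y hy
        have : y ≠ x := by rintro rfl; exact (P k).2.2 hy
        by_cases hk : 0 < k
        · simp [hk, this]
        · simp [hk]
    choose b hb1 hb2 using hbk
    obtain ⟨c, -, hc⟩ := gb_sup (fun i => (P (i + 1)).1.1 i) b (fun k i hi => by
      rw [hb1 k i hi]
      obtain ⟨j, rfl⟩ := Nat.exists_eq_add_of_le (show i + 1 ≤ k from hi)
      exact hlim i j)
    obtain ⟨m, hm⟩ := hCc c x
    have := hb2 (m + 1) m (hmono _ _ (hc (m + 1)) m hm)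
    simp at this
  have hSig : (⋃ k, (Prod.mk k '' T k)).Countable :=
    Set.countable_iUnion fun k => (hTc k).image _
  refine SigmaCompactSpace.of_countable
    ((fun r : ℕ × ((ℕ → ℕ) × Set X) => K r.1 r.2) '' ⋃ k, (Prod.mk k '' T k)) (hSig.image _) ?_ ?_
  · rintro _ ⟨r, hr, rfl⟩
    obtain ⟨k, p, hp, rfl⟩ := Set.mem_iUnion.1 hr
    exact hKc k p (hTg k p hp)
  · rw [Set.sUnion_eq_univ_iff]
    intro x
    obtain ⟨k, p, hp, hx⟩ := hcov x
    exact ⟨_, ⟨(k, p), Set.mem_iUnion.2 ⟨k, p, hp, rfl⟩, rfl⟩, hx⟩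

/-- From a Lindelöf completely regular space: functions adapted to increasing covers. -/
lemma gb_function {X : Type*} [TopologicalSpace X] [CompletelyRegularSpace X]
    (hL : ∀ F : Set (Set X), (∀ W ∈ F, IsOpen W) → ∃ G ⊆ F, G.Countable ∧ ⋃₀ F ⊆ ⋃₀ G)
    (O : ℕ → Set X) (hO : GBCover O) :
    ∃ g : X → ℝ, Continuous g ∧ (∀ x, 0 < g x) ∧ ∀ n x, x ∉ O n → g x ≤ (1/2) ^ n := by
  let F : Set (Set X) := {V | ∃ (h : X → ℝ) (n : ℕ), Continuous h ∧ (∀ x, 0 ≤ h x ∧ h x ≤ 1) ∧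
    (∀ x, x ∉ O n → h x = 0) ∧ V = {x | 0 < h x}}
  obtain ⟨G, hGF, hG, hFG⟩ := hL F (by
    rintro _ ⟨h, n, hc, -, -, rfl⟩
    exact isOpen_lt continuous_const hc)
  have hempty : (∅ : Set X) ∈ F := ⟨fun _ => 0, 0, continuous_const, by simp, by simp, by simp⟩
  obtain ⟨V, hV⟩ := (hG.insert ∅).exists_eq_range (Set.insert_nonempty _ _)
  have hVF : ∀ j, V j ∈ F := by
    intro j
    have : V j ∈ insert ∅ G := hV ▸ Set.mem_range_self j
    rcases this with h | h
    · rw [h]; exact hempty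
    · exact hGF h
  have hcov : ∀ x, ∃ j, x ∈ V j := by
    intro x
    have hx : x ∈ ⋃₀ F := by
      obtain ⟨n, hn⟩ := hO.2.2 x
      obtain ⟨f, hf, h0, h1⟩ := CompletelyRegularSpace.completely_regular x (O n)ᶜ
        (hO.2.1 n).isClosed_compl (by simpa using hn)
      refine ⟨_, ⟨fun y => 1 - (f y : ℝ), n, by fun_prop, fun y => ⟨?_, ?_⟩, fun y hy => ?_, rfl⟩, ?_⟩
      · linarith [(f y).2.2]
      · linarith [(f y).2.1]
      · have := h1 (show y ∈ (O n)ᶜ from hy)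
        simp [this]
      · simp [h0]
    obtain ⟨T, hT, hxT⟩ := hFG hx
    have : T ∈ Set.range V := hV ▸ Set.mem_insert_of_mem _ hT
    obtain ⟨j, rfl⟩ := this
    exact ⟨j, hxT⟩
  choose h n hc h01 hz hVh using hVF
  have hgeo : Summable fun j : ℕ => ((1:ℝ)/2) ^ j := summable_geometric_two
  have hle : ∀ j x, (1/2 : ℝ) ^ (j + n j + 1) * h j x ≤ (1/2) ^ j := by
    intro j x
    calc (1/2 : ℝ) ^ (j + n j + 1) * h j x ≤ (1/2 : ℝ) ^ (j + n j + 1) * 1 := by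
          gcongr; exact (h01 j x).2
      _ ≤ (1/2) ^ j := by
          rw [mul_one]
          exact pow_le_pow_of_le_one (by norm_num) (by norm_num) (by omega)
  have hnn : ∀ j x, 0 ≤ (1/2 : ℝ) ^ (j + n j + 1) * h j x := fun j x =>
    mul_nonneg (by positivity) (h01 j x).1
  have hsum : ∀ x, Summable fun j => (1/2 : ℝ) ^ (j + n j + 1) * h j x := fun x =>
    Summable.of_nonneg_of_le (fun j => hnn j x) (fun j => hle j x) hgeo
  refine ⟨fun x => ∑' j, (1/2 : ℝ) ^ (j + n j + 1) * h j x, ?_, ?_, ?_⟩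
  · refine continuous_tsum (u := fun j => ((1:ℝ)/2) ^ j)
      (fun j => continuous_const.mul (hc j)) hgeo fun j x => ?_
    rw [Real.norm_of_nonneg (hnn j x)]
    exact hle j x
  · intro x
    obtain ⟨j, hj⟩ := hcov x
    rw [hVh j] at hj
    have hj' : 0 < h j x := hj
    exact (hsum x).tsum_pos (fun j => hnn j x) j (by positivity)
  · intro m x hx
    have h3 : ∀ j, (1/2 : ℝ) ^ (j + n j + 1) * h j x ≤ (1/2) ^ (m + 1) * (1/2) ^ j := by
      intro j
      by_cases hj : n j ≤ m
      · rw [hz j x (fun h => hx (hO.1 hj h))]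
        simp only [mul_zero]; positivity
      · calc (1/2 : ℝ) ^ (j + n j + 1) * h j x ≤ (1/2 : ℝ) ^ (j + n j + 1) * 1 := by
              gcongr; exact (h01 j x).2
          _ ≤ (1/2) ^ (m + 1 + j) := by
              rw [mul_one]
              exact pow_le_pow_of_le_one (by norm_num) (by norm_num) (by omega)
          _ = _ := pow_add _ _ _
    calc _ ≤ ∑' j : ℕ, ((1/2 : ℝ)) ^ (m + 1) * (1/2) ^ j :=
          (hsum x).tsum_le_tsum h3 (hgeo.mul_left _)
      _ = (1/2) ^ m := by
          rw [tsum_mul_left, tsum_geometric_two, pow_succ]; ring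

/-- Assume `ω₁ < 𝔟`. If the finest compatible uniformity of a completely regular
Hausdorff space `X` is ω-narrow and has a `𝔊`-base, then `X` is cosmic and σ-compact. -/
theorem cosmic_sigmaCompact_of_omegaNarrow_gBase
    {X : Type*} [t : TopologicalSpace X] [CompletelyRegularSpace X] [T2Space X]
    (hb : ∀ B : Set (ℕ → ℕ), Cardinal.mk ↥B ≤ Cardinal.aleph 1 →
      ∃ C : Set (ℕ → ℕ), C.Countable ∧ ∀ f ∈ B, ∃ g ∈ C, f ≤ g)
    (hfine : ∃ u : UniformSpace X, u.toTopologicalSpace = t ∧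
      (∀ d : X → X → ℝ, (∀ x, d x x = 0) → (∀ x y, d x y = d y x) →
        (∀ x y z, d x z ≤ d x y + d y z) →
        Continuous (fun p : X × X => d p.1 p.2) →
        ∀ ε : ℝ, 0 < ε → {p : X × X | d p.1 p.2 < ε} ∈ @uniformity X u) ∧
      (∀ U ∈ @uniformity X u, ∃ C : Set X, C.Countable ∧ ∀ x : X, ∃ c ∈ C, (c, x) ∈ U) ∧
      ∃ U : (ℕ → ℕ) → Set (X × X), (∀ α, U α ∈ @uniformity X u) ∧
        (∀ V ∈ @uniformity X u, ∃ α, U α ⊆ V) ∧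
        ∀ α β : ℕ → ℕ, α ≤ β → U β ⊆ U α) :
    Cosmic X ∧ SigmaCompactSpace X := by
  obtain ⟨u, rfl, hd, hnar, U, hU, hbase, hmono⟩ := hfine
  have hfun' : ∀ ε : ℝ, 0 < ε → ∀ f : X → ℝ, Continuous f →
      ∃ α, ∀ p ∈ U α, |f p.1 - f p.2| < ε := by
    intro ε hε f hf
    obtain ⟨α, hα⟩ := hbase _ (hd (fun x y => |f x - f y|) (by simp)
      (fun x y => abs_sub_comm _ _) (fun x y z => abs_sub_le _ _ _) (by fun_prop) ε hε)
    exact ⟨α, fun p hp => hα hp⟩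
  have hfun := hfun' (1/8) (by norm_num)
  obtain ⟨D, hD, hDd⟩ := gb_separable hb U hU hmono hfun hnar
  rcases isEmpty_or_nonempty X with hX | hX
  · exact ⟨⟨∅, Set.countable_empty, fun y => (hX.false y).elim⟩, inferInstance⟩
  obtain ⟨d, hdD⟩ := hD.exists_eq_range hDd.nonempty
  have hdU : ∀ α x, ∃ i, (d i, x) ∈ U α := by
    intro α x
    have h1 : {y | (y, x) ∈ U α} ∈ nhds x := mem_nhds_right x (hU α)
    obtain ⟨y, hyD, hy⟩ := hDd.inter_nhds_nonempty h1
    rw [hdD] at hyD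
    obtain ⟨i, rfl⟩ := hyD
    exact ⟨i, hy⟩
  obtain ⟨N, hN, hnet⟩ := gb_cosmic U hmono hfun d hdU
  refine ⟨⟨N, hN, hnet⟩, ?_⟩
  have hL := gb_lindelof N hN hnet
  refine gb_sigma hL (fun φ n => {x | ∃ i, φ (2 * i + 1) ≤ n ∧ (d i, x) ∈ U fun k => φ (2 * k)})
    ?_ ?_ ?_
  · rintro α β hαβ m x ⟨i, hi, hx⟩
    exact ⟨i, (hαβ _).trans hi, hmono _ _ (fun k => hαβ (2 * k)) hx⟩
  · intro φ x
    obtain ⟨i, hi⟩ := hdU (fun k => φ (2 * k)) x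
    exact ⟨φ (2 * i + 1), i, le_rfl, hi⟩
  · intro O hO
    obtain ⟨g, hg, hpos, hgO⟩ := gb_function hL O hO
    obtain ⟨α, hα⟩ := hfun' 1 one_pos (fun x => Real.log (g x))
      (hg.log fun x => (hpos x).ne')
    have hγ : ∀ i, ∃ n : ℕ, (1/2 : ℝ) ^ n < g (d i) / Real.exp 1 := fun i =>
      exists_pow_lt_of_lt_one (div_pos (hpos _) (Real.exp_pos 1)) (by norm_num)
    choose γ hγ using hγ
    refine ⟨fun k => if k % 2 = 0 then α (k / 2) else γ (k / 2), ?_⟩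
    rintro m x ⟨i, hi, hx⟩
    have e1 : (2 * i + 1) % 2 = 1 := by omega
    have e2 : (2 * i + 1) / 2 = i := by omega
    simp only [e1, e2, one_ne_zero, if_false] at hi
    have e3 : (fun k => if 2 * k % 2 = 0 then α (2 * k / 2) else γ (2 * k / 2)) = α := by
      funext k
      have h1 : 2 * k % 2 = 0 := by omega
      have h2 : 2 * k / 2 = k := by omega
      simp [h2]
    rw [e3] at hx
    have h4 := (abs_lt.1 (hα _ hx)).2
    simp only at h4
    by_contra hxm
    have h5 : x ∉ O (γ i) := fun h => hxm (hO.1 hi h)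
    have h6 := (hgO _ _ h5).trans_lt (hγ i)
    have h7 := Real.log_lt_log (hpos x) h6
    rw [Real.log_div (hpos _).ne' (Real.exp_pos 1).ne', Real.log_exp] at h7
    linarith
end
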